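/- arXiv:math/0401248 — 3 statements merged into one kernel-verified Lean document; each statement's English description precedes it below -/
import Mathlib

section
/- For every L there exists a constant A_L (depending only on L) such that for every segment Λ ⊂ ℤ with |Λ| = L, every x ∈ Λ, every N > 0 and every t ∈ [−1,1], ν_Λ^N[ exp( t N (h(η_x) − ν_Λ^N[h(η_x)]) ) ] ≤ A_L exp( A_L (N t² + √N |t|) ), where h(n) := (n+1)/c(n+1). -/
open scoped BigOperators

noncomputable section

/-- `cfact c k = c(k)! = c(1)⋯c(k)`, with `cfact c 0 = 1`. -/
def cfact (c : ℕ → ℝ) : ℕ → ℝ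
  | 0 => 1
  | k + 1 => cfact c k * c (k + 1)

/-- The configuration obtained from `η` by moving one particle from `x` to `y` (`x ≠ y`),
i.e. `η - δ^x + δ^y`. -/
def move (η : ℤ → ℕ) (x y : ℤ) : ℤ → ℕ :=
  fun z => if z = x then η x - 1 else if z = y then η y + 1 else η z

/-- Unnormalized weight of the canonical measure `ν_Λ^N` on configurations supported in `Λ`
with `N` particles: `∏_{x∈Λ} 1/c(η_x)!`. -/
def nuW (c : ℕ → ℝ) (Λ : Finset ℤ) (N : ℕ) : (ℤ → ℕ) → ℝ :=
  Set.indicator {η : ℤ → ℕ | (∀ x, x ∉ Λ → η x = 0) ∧ (∑ x ∈ Λ, η x) = N}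
    (fun η => ∏ x ∈ Λ, (cfact c (η x))⁻¹)

/-- Expectation with respect to the probability measure obtained by normalizing the
nonnegative weight `w`. -/
def wE (w f : (ℤ → ℕ) → ℝ) : ℝ :=
  (∑' η : ℤ → ℕ, w η * f η) / (∑' η : ℤ → ℕ, w η)

/-- Covariance `μ[f,g] = μ[f g] - μ[f] μ[g]`. -/
def wCov (w f g : (ℤ → ℕ) → ℝ) : ℝ :=
  wE w (fun η => f η * g η) - wE w f * wE w g

/-- Entropy `Ent_μ(f) = μ[f log f] - μ[f] log μ[f]` (note `Real.log 0 = 0`, giving the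
convention `0 log 0 = 0`). -/
def wEnt (w f : (ℤ → ℕ) → ℝ) : ℝ :=
  wE w (fun η => f η * Real.log (f η)) - wE w f * Real.log (wE w f)

/-- Dirichlet form of the zero-range process on `Λ`:
`E(f,g) = (1/2) Σ_{x∈Λ} Σ_{y∈Λ, |x-y|=1} μ[c(η_x) ∂_{xy}f ∂_{xy}g]`. -/
def wDir (c : ℕ → ℝ) (Λ : Finset ℤ) (w f g : (ℤ → ℕ) → ℝ) : ℝ :=
  wE w (fun η => (1 / 2) * ∑ x ∈ Λ, ∑ y ∈ Λ,
    if |x - y| = 1 then c (η x) * ((f (move η x y) - f η) * (g (move η x y) - g η)) else 0)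

/-- Weight conditioned on the event `∑_{x ∈ Λ₁} η x = n`. -/
def condW (w : (ℤ → ℕ) → ℝ) (Λ₁ : Finset ℤ) (n : ℕ) : (ℤ → ℕ) → ℝ :=
  Set.indicator {η : ℤ → ℕ | (∑ x ∈ Λ₁, η x) = n} w

/-- `h(n) = (n+1)/c(n+1)`. -/
def hfun (c : ℕ → ℝ) (n : ℕ) : ℝ := (n + 1) / c (n + 1)


lemma s6_upper (c : ℕ → ℝ) (a₁ : ℝ) (hLG : ∀ k : ℕ, |c (k + 1) - c k| ≤ a₁) (j d : ℕ) :
    |c (j + d) - c j| ≤ a₁ * d := by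
  induction d with
  | zero => simp
  | succ d ih =>
    have h := hLG (j + d)
    rw [← add_assoc]
    push_cast
    rw [abs_le] at *
    constructor <;> linarith

lemma s6_lower (c : ℕ → ℝ) (a₁ a₂ : ℝ) (k₀ : ℕ)
    (hLG : ∀ k : ℕ, |c (k + 1) - c k| ≤ a₁)
    (hk₀ : 0 < k₀) (ha₂ : 0 < a₂)
    (hM : ∀ j k : ℕ, j + k₀ ≤ k → a₂ ≤ c k - c j) (j : ℕ) (d : ℕ) :
    a₂ / k₀ * d - (a₁ * k₀ + a₂) ≤ c (j + d) - c j := by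
  have hk : (0 : ℝ) < k₀ := by exact_mod_cast hk₀
  have ha1 : 0 ≤ a₁ := le_trans (abs_nonneg _) (hLG 0)
  induction d using Nat.strong_induction_on with
  | _ d ih =>
    by_cases hd : d < k₀
    · have h := (abs_le.1 (s6_upper c a₁ hLG j d)).1
      have hd' : (d : ℝ) ≤ k₀ := by exact_mod_cast hd.le
      have h1 : a₂ / k₀ * d ≤ a₂ := by
        calc a₂ / k₀ * d ≤ a₂ / k₀ * k₀ := by gcongr
          _ = a₂ := by field_simp
      have h2 : a₁ * d ≤ a₁ * k₀ := by gcongr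
      linarith
    · push Not at hd
      obtain ⟨e, rfl⟩ := Nat.exists_eq_add_of_le hd
      have h1 := ih e (by omega)
      have h2 := hM (j + e) (j + (k₀ + e)) (by omega)
      have h3 : a₂ / k₀ * ((k₀ + e : ℕ) : ℝ) = a₂ + a₂ / k₀ * e := by
        push_cast; field_simp
      rw [h3]; linarith

lemma s6_delta (c : ℕ → ℝ) (α β : ℝ) (hα : 0 < α) (hc0 : c 0 = 0)
    (hcpos : ∀ n : ℕ, 0 < n → 0 < c n)
    (h : ∀ d : ℕ, α * d - β ≤ c d) : ∃ δ : ℝ, 0 < δ ∧ ∀ k : ℕ, δ * k ≤ c k := by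
  have key : ∀ K : ℕ, ∃ δ : ℝ, 0 < δ ∧ ∀ k ≤ K, δ * k ≤ c k := by
    intro K
    induction K with
    | zero => exact ⟨1, one_pos, fun k hk => by
        obtain rfl : k = 0 := by omega
        simp [hc0]⟩
    | succ K ih =>
      obtain ⟨δ, hδ, hh⟩ := ih
      have hp := hcpos (K + 1) (by omega)
      refine ⟨min δ (c (K + 1) / (K + 1)), lt_min hδ (by positivity), fun k hk => ?_⟩
      rcases Nat.lt_or_ge k (K + 1) with h1 | h1
      · exact le_trans (by gcongr; exact min_le_left _ _) (hh k (by omega))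
      · obtain rfl : k = K + 1 := by omega
        calc min δ (c (K + 1) / (K + 1)) * ((K + 1 : ℕ) : ℝ)
            ≤ c (K + 1) / (K + 1) * ((K + 1 : ℕ) : ℝ) := by gcongr; exact min_le_right _ _
          _ = c (K + 1) := by push_cast; field_simp
  obtain ⟨K, hK⟩ := exists_nat_ge (2 * β / α)
  obtain ⟨δ, hδ, hh⟩ := key K
  refine ⟨min δ (α / 2), lt_min hδ (by positivity), fun k => ?_⟩
  rcases Nat.lt_or_ge K k with h1 | h1
  · have h2 : (K : ℝ) ≤ k := by exact_mod_cast h1.le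
    have h3 : 2 * β / α ≤ k := hK.trans h2
    rw [div_le_iff₀ hα] at h3
    calc min δ (α / 2) * k ≤ α / 2 * k := by gcongr; exact min_le_right _ _
      _ ≤ α * k - β := by linarith
      _ ≤ c k := h k
  · exact le_trans (by gcongr; exact min_le_left _ _) (hh k h1)

/-- log of `cfact`. -/
def s6F (c : ℕ → ℝ) (k : ℕ) : ℝ := ∑ j ∈ Finset.range k, Real.log (c (j + 1))

lemma s6F_succ (c : ℕ → ℝ) (k : ℕ) : s6F c (k + 1) = s6F c k + Real.log (c (k + 1)) :=
  Finset.sum_range_succ _ _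

lemma s6_cfact (c : ℕ → ℝ) (hcpos : ∀ n : ℕ, 0 < n → 0 < c n) (k : ℕ) :
    (cfact c k)⁻¹ = Real.exp (-s6F c k) := by
  induction k with
  | zero => simp [cfact, s6F]
  | succ k ih =>
    rw [cfact, s6F_succ, mul_inv, ih, neg_add, Real.exp_add, Real.exp_neg (Real.log _),
      Real.exp_log (hcpos _ (by omega))]

lemma s6_logsub (u v : ℝ) (hu : 0 < u) (hv : 0 < v) :
    Real.log u - Real.log v ≤ (u - v) / v := by
  rw [← Real.log_div hu.ne' hv.ne', sub_div, div_self hv.ne']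
  exact Real.log_le_sub_one_of_pos (by positivity)

lemma s6_up_lower (c : ℕ → ℝ) (a₁ α β δ : ℝ)
    (ha1 : 0 < a₁)
    (hα : 0 < α)
    (hβ : 0 < β)
    (hδ : 0 < δ)
    (hcpos : ∀ n : ℕ, 0 < n → 0 < c n)
    (hl : ∀ j d : ℕ, α * d - β ≤ c (j + d) - c j)
    (hc1 : ∀ k : ℕ, c k ≤ a₁ * k)
    (hc2 : ∀ k : ℕ, δ * k ≤ c k)
    (m N : ℕ) (hN : 1 ≤ N) (i : ℕ) (hi : m + i ≤ N) :
    Real.log (c (m + 1)) * i + α / (a₁ * N) * (i * (i - 1) / 2) - β / (δ * (m + 1)) * i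
      ≤ s6F c (m + i) - s6F c m := by
  have hN' : (0 : ℝ) < N := by exact_mod_cast hN
  induction i with
  | zero => simp
  | succ i ih =>
    have h1 := ih (by omega)
    rw [← add_assoc, s6F_succ]
    have hp := hcpos (m + i + 1) (by omega)
    have hp' := hcpos (m + 1) (by omega)
    have h2 := s6_logsub _ _ hp' hp
    have h3 := hl (m + 1) i
    rw [show m + 1 + i = m + i + 1 by ring] at h3
    have h4 : (c (m + 1) - c (m + i + 1)) / c (m + i + 1) ≤
        (β - α * i) / c (m + i + 1) := div_le_div_of_nonneg_right (by linarith) hp.le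
    have h5 : c (m + i + 1) ≤ a₁ * N := (hc1 _).trans (by
      gcongr; omega)
    have h6 : δ * (m + 1) ≤ c (m + i + 1) := by
      refine le_trans ?_ (hc2 _)
      gcongr; push_cast; linarith [(Nat.cast_nonneg i : (0:ℝ) ≤ i)]
    have h7 : α * i / (a₁ * N) ≤ α * i / c (m + i + 1) := by gcongr
    have h8 : β / c (m + i + 1) ≤ β / (δ * (m + 1)) := by gcongr
    rw [sub_div β] at h4
    have h9 : α / (a₁ * N) * (((i + 1 : ℕ) : ℝ) * (((i + 1 : ℕ) : ℝ) - 1) / 2) =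
      α / (a₁ * N) * (i * (i - 1) / 2) + α * i / (a₁ * N) := by push_cast; ring
    rw [h9]; push_cast
    linarith

lemma s6_down_lower (c : ℕ → ℝ) (a₁ α β δ : ℝ)
    (ha1 : 0 < a₁)
    (hα : 0 < α)
    (hβ : 0 < β)
    (hδ : 0 < δ)
    (hcpos : ∀ n : ℕ, 0 < n → 0 < c n)
    (hl : ∀ j d : ℕ, α * d - β ≤ c (j + d) - c j)
    (hc1 : ∀ k : ℕ, c k ≤ a₁ * k)
    (hc2 : ∀ k : ℕ, δ * k ≤ c k)
    (m N : ℕ) (hN : 1 ≤ N) (hm : m ≤ N) (i : ℕ) (hi : i ≤ m) :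
    -Real.log (c (m + 1)) * i + α / (2 * a₁ * N) * (i * (i + 1) / 2) - β / (δ * (m + 1)) * i
      ≤ s6F c (m - i) - s6F c m := by
  have hN' : (1 : ℝ) ≤ N := by exact_mod_cast hN
  have hm' : (m : ℝ) ≤ N := by exact_mod_cast hm
  induction i with
  | zero => simp
  | succ i ih =>
    have h1 := ih (by omega)
    obtain ⟨e, rfl⟩ := Nat.exists_eq_add_of_le hi
    rw [show i + 1 + e - i = e + 1 by omega, s6F_succ] at h1
    rw [show i + 1 + e - (i + 1) = e by omega]
    have hp := hcpos (e + 1) (by omega)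
    have hp' := hcpos (i + 1 + e + 1) (by omega)
    have h2 := s6_logsub _ _ hp hp'
    have h3 := hl (e + 1) (i + 1)
    rw [show e + 1 + (i + 1) = i + 1 + e + 1 by ring] at h3
    have h4 : (c (e + 1) - c (i + 1 + e + 1)) / c (i + 1 + e + 1) ≤
        (β - α * (i + 1 : ℕ)) / c (i + 1 + e + 1) :=
      div_le_div_of_nonneg_right (by linarith) hp'.le
    have h5 : c (i + 1 + e + 1) ≤ 2 * a₁ * N := (hc1 _).trans (by
      rw [mul_comm 2 a₁, mul_assoc]
      gcongr; push_cast at *; linarith)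
    have h6 : δ * ((i + 1 + e : ℕ) + 1) ≤ c (i + 1 + e + 1) := by
      refine le_trans ?_ (hc2 _)
      gcongr; push_cast; linarith
    have h7 : α * (i + 1 : ℕ) / (2 * a₁ * N) ≤ α * (i + 1 : ℕ) / c (i + 1 + e + 1) := by gcongr
    have h8 : β / c (i + 1 + e + 1) ≤ β / (δ * ((i + 1 + e : ℕ) + 1)) := by gcongr
    rw [sub_div β] at h4
    have h9 : α / (2 * a₁ * N) * (((i + 1 : ℕ) : ℝ) * (((i + 1 : ℕ) : ℝ) + 1) / 2) =
      α / (2 * a₁ * N) * (i * (i + 1) / 2) + α * (i + 1 : ℕ) / (2 * a₁ * N) := by push_cast; ring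
    rw [h9]
    have h10 : β / (δ * ((i + 1 + e : ℕ) + 1)) * ((i + 1 : ℕ) : ℝ) =
      β / (δ * ((i + 1 + e : ℕ) + 1)) * (i : ℝ) + β / (δ * ((i + 1 + e : ℕ) + 1)) := by
      rw [Nat.cast_succ]; ring
    rw [h10, Nat.cast_succ i, mul_add]
    rw [Nat.cast_succ i] at h7 h4
    linarith

lemma s6_up_upper (c : ℕ → ℝ) (a₁ δ : ℝ)
    (ha1 : 0 < a₁)
    (hδ : 0 < δ)
    (hcpos : ∀ n : ℕ, 0 < n → 0 < c n)
    (hu : ∀ j d : ℕ, |c (j + d) - c j| ≤ a₁ * d)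
    (hc2 : ∀ k : ℕ, δ * k ≤ c k)
    (m : ℕ) (i : ℕ) :
    s6F c (m + i) - s6F c m ≤ Real.log (c (m + 1)) * i + a₁ / (δ * (m + 1)) * i ^ 2 := by
  induction i with
  | zero => simp
  | succ i ih =>
    rw [← add_assoc, s6F_succ]
    have hp := hcpos (m + i + 1) (by omega)
    have hp' := hcpos (m + 1) (by omega)
    have h2 := s6_logsub _ _ hp hp'
    have h3 := (abs_le.1 (hu (m + 1) i)).2
    rw [show m + 1 + i = m + i + 1 by ring] at h3
    have h6 : δ * (m + 1) ≤ c (m + 1) := by simpa using hc2 (m + 1)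
    have h4 : (c (m + i + 1) - c (m + 1)) / c (m + 1) ≤ a₁ * i / (δ * (m + 1)) :=
      (div_le_div_of_nonneg_right h3 hp'.le).trans (by gcongr)
    have h5 : a₁ / (δ * (m + 1)) * (((i + 1 : ℕ) : ℝ)) ^ 2 =
      a₁ / (δ * (m + 1)) * i ^ 2 + a₁ * i / (δ * (m + 1)) + a₁ / (δ * (m + 1)) * (i + 1) := by
      push_cast; ring
    have h7 : 0 ≤ a₁ / (δ * (m + 1)) * (i + 1) := by positivity
    rw [h5]; push_cast; linarith

lemma s6_down_upper (c : ℕ → ℝ) (a₁ δ : ℝ)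
    (ha1 : 0 < a₁)
    (hδ : 0 < δ)
    (hcpos : ∀ n : ℕ, 0 < n → 0 < c n)
    (hu : ∀ j d : ℕ, |c (j + d) - c j| ≤ a₁ * d)
    (hc2 : ∀ k : ℕ, δ * k ≤ c k)
    (m : ℕ) (i : ℕ) (hi : 2 * i ≤ m + 1) (him : i ≤ m) :
    s6F c (m - i) - s6F c m ≤
      -Real.log (c (m + 1)) * i + 2 * a₁ / (δ * (m + 1)) * (i * (i + 1)) := by
  induction i with
  | zero => simp
  | succ i ih =>
    have h1 := ih (by omega) (by omega)
    obtain ⟨e, rfl⟩ := Nat.exists_eq_add_of_le him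
    rw [show i + 1 + e - i = e + 1 by omega, s6F_succ] at h1
    rw [show i + 1 + e - (i + 1) = e by omega]
    have hp := hcpos (e + 1) (by omega)
    have hp' := hcpos (i + 1 + e + 1) (by omega)
    have h2 := s6_logsub _ _ hp' hp
    have h3 := (abs_le.1 (hu (e + 1) (i + 1))).2
    rw [show e + 1 + (i + 1) = i + 1 + e + 1 by ring] at h3
    have h6 : δ * ((i + 1 + e : ℕ) + 1) / 2 ≤ c (e + 1) := by
      refine le_trans ?_ (hc2 _)
      rw [mul_div_assoc]
      gcongr
      have : ((i + 1 + e + 1 : ℕ) : ℝ) ≤ (2 * (e + 1) : ℕ) := by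
        norm_cast; omega
      push_cast at *; linarith
    have h4 : (c (i + 1 + e + 1) - c (e + 1)) / c (e + 1) ≤
        a₁ * (i + 1 : ℕ) / (δ * ((i + 1 + e : ℕ) + 1) / 2) :=
      (div_le_div_of_nonneg_right h3 hp.le).trans (by gcongr)
    set D : ℝ := δ * ((i + 1 + e : ℕ) + 1) with hD
    have hDp : 0 < D := by positivity
    have h5 : 2 * a₁ / D * (((i + 1 : ℕ) : ℝ) * (((i + 1 : ℕ) : ℝ) + 1)) =
      2 * a₁ / D * (i * (i + 1)) + a₁ * (i + 1 : ℕ) / (D / 2) + a₁ * (i + 1 : ℕ) / (D / 2) := by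
      push_cast; field_simp
      try ring
    have h7 : 0 ≤ a₁ * (i + 1 : ℕ) / (D / 2) := by positivity
    rw [h5, Nat.cast_succ i] 
    rw [Nat.cast_succ i] at h4 h7
    linarith


lemma s6_F_lower (c : ℕ → ℝ) (a₁ α β δ : ℝ)
    (ha1 : 0 < a₁)
    (hα : 0 < α)
    (hβ : 0 < β)
    (hδ : 0 < δ)
    (hcpos : ∀ n : ℕ, 0 < n → 0 < c n)
    (hl : ∀ j d : ℕ, α * d - β ≤ c (j + d) - c j)
    (hc1 : ∀ k : ℕ, c k ≤ a₁ * k)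
    (hc2 : ∀ k : ℕ, δ * k ≤ c k)
    (L m N : ℕ) (hN : 1 ≤ N) (hL : 1 ≤ L) (hm : m ≤ N) (hNL : N ≤ L * (m + 1))
    (k : ℕ) (hk : k ≤ N) :
    Real.log (c (m + 1)) * ((k : ℝ) - m) + α / (4 * a₁) * ((k : ℝ) - m) ^ 2 / N
      - (β * L / δ + α / (2 * a₁)) ≤ s6F c k - s6F c m := by
  have hN' : (1 : ℝ) ≤ N := by exact_mod_cast hN
  have hL' : (1 : ℝ) ≤ L := by exact_mod_cast hL
  have hNL' : (N : ℝ) ≤ L * (m + 1) := by exact_mod_cast hNL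
  have hb : ∀ i : ℕ, i ≤ N → β / (δ * (m + 1)) * i ≤ β * L / δ := by
    intro i hi
    have hi' : (i : ℝ) ≤ N := by exact_mod_cast hi
    rw [div_mul_eq_mul_div, div_le_div_iff₀ (by positivity) hδ]
    have : (i : ℝ) ≤ L * (m + 1) := hi'.trans hNL'
    calc β * i * δ ≤ β * (L * (m + 1)) * δ := by gcongr
      _ = _ := by ring
  rcases le_total m k with h | h
  · obtain ⟨i, rfl⟩ := Nat.exists_eq_add_of_le h
    have h1 := s6_up_lower c a₁ α β δ ha1 hα hβ hδ hcpos hl hc1 hc2 m N hN i hk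
    have h2 := hb i (by omega)
    have hi' : (i : ℝ) ≤ N := by exact_mod_cast (by omega : i ≤ N)
    have h3 : α / (a₁ * N) * ((i : ℝ) * (i - 1) / 2) =
      α / (4 * a₁) * i ^ 2 / N + α / (4 * a₁) * i ^ 2 / N - α / (2 * a₁) * (i / N) := by
      field_simp; ring
    have h4 : α / (2 * a₁) * (i / N) ≤ α / (2 * a₁) * 1 := by
      gcongr; rw [div_le_one (by positivity)]; exact hi'
    have h5 : 0 ≤ α / (4 * a₁) * (i : ℝ) ^ 2 / N := by positivity
    rw [show ((m + i : ℕ) : ℝ) - m = i by push_cast; ring]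
    linarith
  · obtain ⟨i, rfl⟩ := Nat.exists_eq_add_of_le h
    have h1 := s6_down_lower c a₁ α β δ ha1 hα hβ hδ hcpos hl hc1 hc2 (k + i) N hN hm i (by omega)
    rw [Nat.add_sub_cancel] at h1
    have h2 := hb i (by omega)
    have h3 : α / (2 * a₁ * N) * ((i : ℝ) * (i + 1) / 2) =
      α / (4 * a₁) * i ^ 2 / N + α / (4 * a₁) * i / N := by
      field_simp; ring
    have h5 : 0 ≤ α / (4 * a₁) * (i : ℝ) / N := by positivity
    have h6 : 0 ≤ α / (2 * a₁) := by positivity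
    rw [show (k : ℝ) - ((k + i : ℕ) : ℝ) = -i by push_cast; ring, neg_sq]
    linarith

lemma s6_F_upper_down (c : ℕ → ℝ) (a₁ δ : ℝ)
    (ha1 : 0 < a₁)
    (hδ : 0 < δ)
    (hcpos : ∀ n : ℕ, 0 < n → 0 < c n)
    (hu : ∀ j d : ℕ, |c (j + d) - c j| ≤ a₁ * d)
    (hc2 : ∀ k : ℕ, δ * k ≤ c k)
    (L m : ℕ) (hL : 1 ≤ L) (i : ℕ) (hi : i ≤ Nat.sqrt m) :
    s6F c (m - i) - s6F c m ≤
      Real.log (c (m + 1)) * (((m - i : ℕ) : ℝ) - m) + 4 * a₁ * L ^ 2 / δ := by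
  have hL' : (1 : ℝ) ≤ L := by exact_mod_cast hL
  have h0 : i * i ≤ m := Nat.le_sqrt.1 hi
  have him : i ≤ m := by nlinarith
  have h2i : 2 * i ≤ m + 1 := by
    zify at *; nlinarith [sq_nonneg ((i : ℤ) - 1)]
  have h1 := s6_down_upper c a₁ δ ha1 hδ hcpos hu hc2 m i h2i him
  have h0' : (i : ℝ) * i ≤ m := by exact_mod_cast h0
  have h2 : (i : ℝ) * (i + 1) ≤ 2 * (m + 1) := by
    have : (i : ℝ) ≤ m := by exact_mod_cast him
    linarith
  have h3 : 2 * a₁ / (δ * (m + 1)) * ((i : ℝ) * (i + 1)) ≤ 4 * a₁ * L ^ 2 / δ := by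
    calc 2 * a₁ / (δ * (m + 1)) * ((i : ℝ) * (i + 1)) ≤ 2 * a₁ / (δ * (m + 1)) * (2 * (m + 1)) := by
          gcongr
      _ = 4 * a₁ * 1 ^ 2 / δ := by field_simp; ring
      _ ≤ _ := by gcongr
  rw [Nat.cast_sub him]
  linarith

lemma s6_F_upper_up (c : ℕ → ℝ) (a₁ δ : ℝ)
    (ha1 : 0 < a₁)
    (hδ : 0 < δ)
    (hcpos : ∀ n : ℕ, 0 < n → 0 < c n)
    (hu : ∀ j d : ℕ, |c (j + d) - c j| ≤ a₁ * d)
    (hc2 : ∀ k : ℕ, δ * k ≤ c k)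
    (L m : ℕ) (i : ℕ) (hi : i ≤ L * (Nat.sqrt m + 1)) :
    s6F c (m + i) - s6F c m ≤
      Real.log (c (m + 1)) * (((m + i : ℕ) : ℝ) - m) + 4 * a₁ * L ^ 2 / δ := by
  have h1 := s6_up_upper c a₁ δ ha1 hδ hcpos hu hc2 m i
  have h0 : Nat.sqrt m * Nat.sqrt m ≤ m := Nat.sqrt_le m
  have h0' : (Nat.sqrt m : ℝ) * Nat.sqrt m ≤ m := by exact_mod_cast h0
  have hi' : (i : ℝ) ≤ L * (Nat.sqrt m + 1) := by exact_mod_cast hi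
  have h2 : (i : ℝ) ^ 2 ≤ L ^ 2 * (4 * (m + 1)) := by
    calc (i : ℝ) ^ 2 ≤ ((L : ℝ) * (Nat.sqrt m + 1)) ^ 2 := by gcongr
      _ = (L : ℝ) ^ 2 * (Nat.sqrt m + 1) ^ 2 := by ring
      _ ≤ _ := by gcongr; nlinarith [sq_nonneg ((Nat.sqrt m : ℝ) - 1)]
  have h3 : a₁ / (δ * (m + 1)) * (i : ℝ) ^ 2 ≤ 4 * a₁ * L ^ 2 / δ := by
    calc a₁ / (δ * (m + 1)) * (i : ℝ) ^ 2 ≤ a₁ / (δ * (m + 1)) * (L ^ 2 * (4 * (m + 1))) := by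
          gcongr
      _ = _ := by field_simp
  rw [show ((m + i : ℕ) : ℝ) - m = i by push_cast; ring]
  linarith

/-- Weight in exponential form. -/
def s6W (c : ℕ → ℝ) (Λ : Finset ℤ) (η : ℤ → ℕ) : ℝ := Real.exp (-∑ y ∈ Λ, s6F c (η y))

lemma s6_tsum (c : ℕ → ℝ) (hcpos : ∀ n : ℕ, 0 < n → 0 < c n) (Λ : Finset ℤ) (N : ℕ)
    (f : (ℤ → ℕ) → ℝ) :
    ∑' η : ℤ → ℕ, nuW c Λ N η * f η = ∑ η ∈ Finset.piAntidiag Λ N, s6W c Λ η * f η := by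
  have hmem : ∀ η : ℤ → ℕ, η ∈ {η : ℤ → ℕ | (∀ x, x ∉ Λ → η x = 0) ∧ (∑ x ∈ Λ, η x) = N} ↔
      η ∈ Finset.piAntidiag Λ N := by
    intro η
    rw [Finset.mem_piAntidiag, Set.mem_ofPred_eq, and_comm]
    refine and_congr_right fun _ => forall_congr' fun x => ?_
    tauto
  rw [tsum_eq_sum (s := Finset.piAntidiag Λ N)]
  · refine Finset.sum_congr rfl fun η hη => ?_
    rw [nuW, Set.indicator_of_mem ((hmem η).2 hη), s6W, ← Finset.sum_neg_distrib, Real.exp_sum]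
    congr 1
    exact Finset.prod_congr rfl fun y _ => s6_cfact c hcpos _
  · intro η hη
    rw [nuW, Set.indicator_of_notMem (fun h => hη ((hmem η).1 h)), zero_mul]

lemma s6_wE (c : ℕ → ℝ) (hcpos : ∀ n : ℕ, 0 < n → 0 < c n) (Λ : Finset ℤ) (N : ℕ)
    (f : (ℤ → ℕ) → ℝ) :
    wE (nuW c Λ N) f = (∑ η ∈ Finset.piAntidiag Λ N, s6W c Λ η * f η) /
      ∑ η ∈ Finset.piAntidiag Λ N, s6W c Λ η := by
  have h := s6_tsum c hcpos Λ N (fun _ => 1)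
  simp only [mul_one] at h
  rw [wE, s6_tsum c hcpos, h]

lemma s6_geom (ρ : ℝ) (h0 : 0 ≤ ρ) (h1 : ρ < 1) (n : ℕ) :
    ∑ k ∈ Finset.range n, ρ ^ k ≤ (1 - ρ)⁻¹ :=
  sum_le_hasSum _ (fun _ _ => by positivity) (hasSum_geometric_of_lt_one h0 h1)

lemma s6_geom2 (q : ℝ) (hq : 0 < q) (m n : ℕ) :
    ∑ k ∈ Finset.range n, Real.exp (-(q * |(k : ℝ) - m|)) ≤ 2 * (1 - Real.exp (-q))⁻¹ := by
  have h1 : Real.exp (-q) < 1 := by rw [Real.exp_lt_one_iff]; linarith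
  have hp : ∀ i : ℕ, Real.exp (-(q * i)) = Real.exp (-q) ^ i := by
    intro i; rw [← Real.exp_nat_mul]; congr 1; ring
  have hsub : Finset.range n ⊆ Finset.range (m + n) := Finset.range_mono (by omega)
  refine (Finset.sum_le_sum_of_subset_of_nonneg hsub (fun _ _ _ => (Real.exp_pos _).le)).trans ?_
  rw [Finset.sum_range_add, two_mul]
  refine add_le_add ?_ ?_
  · rw [← Finset.sum_range_reflect]
    refine le_trans (Finset.sum_le_sum fun k hk => ?_) (s6_geom _ (Real.exp_pos _).le h1 m)
    rw [← hp]
    have hk' := Finset.mem_range.1 hk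
    have e : ((m - 1 - k : ℕ) : ℝ) - m = -(k + 1) := by
      have : m - 1 - k + (k + 1) = m := by omega
      have h : ((m - 1 - k : ℕ) : ℝ) + (k + 1) = m := by exact_mod_cast this
      linarith
    rw [e, abs_neg, abs_of_nonneg (by positivity)]
    gcongr; linarith
  · refine le_trans (Finset.sum_le_sum fun k hk => ?_) (s6_geom _ (Real.exp_pos _).le h1 n)
    rw [← hp]
    apply le_of_eq
    rw [show ((m + k : ℕ) : ℝ) - m = k by push_cast; ring, abs_of_nonneg (by positivity)]

lemma s6_gauss (κ : ℝ) (hκ : 0 < κ) (R N : ℝ) (hN : 0 < N) (hR : 1 ≤ R) (hNR : N ≤ R ^ 2)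
    (m n : ℕ) :
    ∑ k ∈ Finset.range n, Real.exp (-(κ * ((k : ℝ) - m) ^ 2 / N)) ≤
      Real.exp κ * (2 * (1 + 1 / (2 * κ))) * R := by
  have hq : 0 < 2 * κ / R := by positivity
  calc ∑ k ∈ Finset.range n, Real.exp (-(κ * ((k : ℝ) - m) ^ 2 / N))
      ≤ ∑ k ∈ Finset.range n, Real.exp κ * Real.exp (-(2 * κ / R * |(k : ℝ) - m|)) := by
        refine Finset.sum_le_sum fun k _ => ?_
        rw [← Real.exp_add]
        apply Real.exp_le_exp.2
        set d := |(k : ℝ) - m| with hd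
        rw [← sq_abs ((k : ℝ) - m), ← hd]
        have h1 : κ * d ^ 2 / R ^ 2 ≤ κ * d ^ 2 / N := by gcongr
        have h2 : 0 ≤ κ * (d / R - 1) ^ 2 := by positivity
        have h3 : κ * (d / R - 1) ^ 2 = κ * d ^ 2 / R ^ 2 - 2 * κ / R * d + κ := by
          field_simp; ring
        linarith
    _ = Real.exp κ * ∑ k ∈ Finset.range n, Real.exp (-(2 * κ / R * |(k : ℝ) - m|)) := by
        rw [Finset.mul_sum]
    _ ≤ Real.exp κ * (2 * (1 - Real.exp (-(2 * κ / R)))⁻¹) := by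
        gcongr; exact s6_geom2 _ hq m n
    _ ≤ Real.exp κ * (2 * (1 + 1 / (2 * κ / R))) := by
        gcongr
        set q := 2 * κ / R
        have h1 : Real.exp (-q) ≤ (1 + q)⁻¹ := by
          rw [Real.exp_neg]
          gcongr
          linarith [Real.add_one_le_exp q]
        have h2 : (1 + 1 / q)⁻¹ ≤ 1 - Real.exp (-q) := by
          have : (1 + 1 / q)⁻¹ = 1 - (1 + q)⁻¹ := by field_simp; ring
          linarith
        exact inv_le_of_inv_le₀ (by positivity) h2
    _ ≤ Real.exp κ * (2 * (R * (1 + 1 / (2 * κ)))) := by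
        gcongr
        have : 1 / (2 * κ / R) = R * (1 / (2 * κ)) := by field_simp
        rw [this]; linarith
    _ = _ := by ring

/-- Dropping one site. -/
lemma s6_sum_upper (S : Finset ℤ) (x : ℤ) (hx : x ∉ S) (N : ℕ) (g : ℕ → ℝ)
    (hg : ∀ k, 0 ≤ g k) :
    ∑ η ∈ Finset.piAntidiag (insert x S) N, ∏ y ∈ S, g (η y) ≤
      (∑ k ∈ Finset.range (N + 1), g k) ^ S.card := by
  classical
  have h1 : (∑ k ∈ Finset.range (N + 1), g k) ^ S.card =
      ∑ p ∈ Fintype.piFinset (fun _ : S => Finset.range (N + 1)), ∏ y, g (p y) := by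
    rw [← Finset.prod_univ_sum]; simp
  rw [h1]
  have hle : ∀ η ∈ Finset.piAntidiag (insert x S) N, ∀ y ∈ insert x S, η y ≤ N := by
    intro η hη y hy
    rw [Finset.mem_piAntidiag] at hη
    rw [← hη.1]
    exact Finset.single_le_sum (f := η) (fun _ _ => Nat.zero_le _) hy
  have hinj : Set.InjOn (fun (η : ℤ → ℕ) (y : S) => η y)
      (Finset.piAntidiag (insert x S) N : Set (ℤ → ℕ)) := by
    intro η hη ξ hξ h
    rw [Finset.mem_coe, Finset.mem_piAntidiag] at hη hξ
    have hS : ∀ y ∈ S, η y = ξ y := fun y hy => congrFun h ⟨y, hy⟩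
    funext z
    by_cases hz : z ∈ S
    · exact hS z hz
    by_cases hzx : z = x
    · subst hzx
      have e1 := hη.1
      have e2 := hξ.1
      rw [Finset.sum_insert hx] at e1 e2
      have : ∑ y ∈ S, η y = ∑ y ∈ S, ξ y := Finset.sum_congr rfl hS
      omega
    · have hni : z ∉ insert x S := by simp [hz, hzx]
      have e1 : η z = 0 := by by_contra hh; exact hni (hη.2 z hh)
      have e2 : ξ z = 0 := by by_contra hh; exact hni (hξ.2 z hh)
      rw [e1, e2]
  have h2 : ∑ η ∈ Finset.piAntidiag (insert x S) N, ∏ y ∈ S, g (η y) =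
      ∑ p ∈ (Finset.piAntidiag (insert x S) N).image (fun (η : ℤ → ℕ) (y : S) => η y),
        ∏ y, g (p y) := by
    rw [Finset.sum_image hinj]
    refine Finset.sum_congr rfl fun η _ => ?_
    exact (Finset.prod_coe_sort S (fun y => g (η y))).symm
  rw [h2]
  refine Finset.sum_le_sum_of_subset_of_nonneg ?_ (fun p _ _ => Finset.prod_nonneg fun _ _ => hg _)
  intro p hp
  obtain ⟨η, hη, rfl⟩ := Finset.mem_image.1 hp
  rw [Fintype.mem_piFinset]
  intro y
  rw [Finset.mem_range]
  exact Nat.lt_succ_of_le (hle η hη y (Finset.mem_insert_of_mem y.2))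

/-- Counting configurations close to the balanced one. -/
lemma s6_sum_lower (S : Finset ℤ) (x : ℤ) (hx : x ∉ S) (N m r : ℕ) (hr : r ≤ m)
    (hm1 : (S.card + 1) * m ≤ N) (hm2 : N ≤ (S.card + 1) * (m + 1))
    (W : (ℤ → ℕ) → ℝ) (hW : ∀ η, 0 ≤ W η) (w : ℝ)
    (hw : ∀ η : ℤ → ℕ, ∑ y ∈ insert x S, η y = N → (∀ y ∈ S, ∃ i ≤ r, η y = m - i) →
      (∃ i ≤ (S.card + 1) * (r + 1), η x = m + i) → w ≤ W η) :
    ((r : ℝ) + 1) ^ S.card * w ≤ ∑ η ∈ Finset.piAntidiag (insert x S) N, W η := by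
  classical
  let Φ : (S → ℕ) → (ℤ → ℕ) := fun p z =>
    if h : z ∈ S then m - p ⟨z, h⟩ else if z = x then N - ∑ y : S, (m - p y) else 0
  let B := Fintype.piFinset (fun _ : S => Finset.range (r + 1))
  have hΦS : ∀ p (y : S), Φ p y = m - p y := fun p y => by simp [Φ]
  have hΦx : ∀ p, Φ p x = N - ∑ y : S, (m - p y) := fun p => by simp [Φ, hx]
  have hB : ∀ p ∈ B, ∀ y, p y ≤ r := by
    intro p hp y
    have := Fintype.mem_piFinset.1 hp y
    rw [Finset.mem_range] at this; omega
  have hsumS : ∀ p, ∑ y ∈ S, Φ p y = ∑ y : S, (m - p y) := by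
    intro p
    rw [← Finset.sum_coe_sort S]
    exact Finset.sum_congr rfl fun y _ => hΦS p y
  have hs1 : ∀ p : S → ℕ, ∑ y : S, (m - p y) ≤ S.card * m := by
    intro p
    refine (Finset.sum_le_sum (g := fun _ => m) fun y _ => Nat.sub_le _ _).trans ?_
    simp
  have hs2 : ∀ p ∈ B, S.card * m ≤ ∑ y : S, (m - p y) + S.card * r := by
    intro p hp
    have : ∑ y : S, m ≤ ∑ y : S, ((m - p y) + r) :=
      Finset.sum_le_sum fun y _ => by have := hB p hp y; omega
    rw [Finset.sum_add_distrib] at this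
    simpa using this
  have hinj : Set.InjOn Φ (B : Set (S → ℕ)) := by
    intro p hp q hq h
    funext y
    have h1 := congrFun h y
    rw [hΦS, hΦS] at h1
    have h2 := hB p hp y
    have h3 := hB q hq y
    omega
  have hsum : ∀ p, ∑ y ∈ insert x S, Φ p y = N := by
    intro p
    rw [Finset.sum_insert hx, hsumS, hΦx]
    have := hs1 p
    have : S.card * m ≤ (S.card + 1) * m := Nat.mul_le_mul_right _ (by omega)
    omega
  have hcard : (B.card : ℝ) = ((r : ℝ) + 1) ^ S.card := by
    simp [B, Fintype.card_piFinset]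
  calc ((r : ℝ) + 1) ^ S.card * w = ∑ p ∈ B, w := by rw [Finset.sum_const, nsmul_eq_mul, hcard]
    _ ≤ ∑ p ∈ B, W (Φ p) := by
      refine Finset.sum_le_sum fun p hp => ?_
      refine hw _ (hsum p) (fun y hy => ⟨p ⟨y, hy⟩, hB p hp _, hΦS p ⟨y, hy⟩⟩) ?_
      have h1 := hs1 p
      have h2 := hs2 p hp
      refine ⟨Φ p x - m, ?_, ?_⟩
      · rw [hΦx]
        have e1 : (S.card + 1) * (m + 1) = S.card * m + S.card + m + 1 := by ring
        have e2 : (S.card + 1) * (r + 1) = S.card * r + S.card + r + 1 := by ring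
        omega
      · rw [hΦx]
        have e1 : (S.card + 1) * m = S.card * m + m := by ring
        omega
    _ = ∑ η ∈ B.image Φ, W η := by rw [Finset.sum_image hinj]
    _ ≤ _ := by
      refine Finset.sum_le_sum_of_subset_of_nonneg ?_ (fun _ _ _ => hW _)
      intro η hη
      obtain ⟨p, hp, rfl⟩ := Finset.mem_image.1 hη
      rw [Finset.mem_piAntidiag]
      refine ⟨hsum p, fun z hz => ?_⟩
      by_contra hni
      rw [Finset.mem_insert, not_or] at hni
      exact hz (by simp [Φ, hni.1, hni.2])

lemma s6_key (c : ℕ → ℝ) (a₁ α β δ : ℝ)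
    (ha1 : 0 < a₁)
    (hα : 0 < α)
    (hβ : 0 < β)
    (hδ : 0 < δ)
    (hcpos : ∀ n : ℕ, 0 < n → 0 < c n)
    (hu : ∀ j d : ℕ, |c (j + d) - c j| ≤ a₁ * d)
    (hl : ∀ j d : ℕ, α * d - β ≤ c (j + d) - c j)
    (hc1 : ∀ k : ℕ, c k ≤ a₁ * k)
    (hc2 : ∀ k : ℕ, δ * k ≤ c k)
    (L : ℕ) : ∃ B : ℝ, 0 < B ∧
    ∀ (S : Finset ℤ) (x : ℤ) (N : ℕ), x ∉ S → S.card + 1 = L → 1 ≤ N → ∀ s : ℝ, 0 ≤ s →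
      wE (nuW c (insert x S) N) (fun η => Real.exp (s * |(η x : ℝ) - (N / L : ℕ)|)) ≤
        B * Real.exp (B * (N * s ^ 2)) := by
  classical
  set κ : ℝ := α / (4 * a₁) with hκdef
  have hκ : 0 < κ := by positivity
  set C1 : ℝ := β * L / δ + α / (2 * a₁) with hC1
  set C2 : ℝ := 4 * a₁ * L ^ 2 / δ with hC2
  set κ' : ℝ := κ / L with hκ'def
  set C3 : ℝ := Real.exp κ' * (2 * (1 + 1 / (2 * κ'))) with hC3
  set B0 : ℝ := Real.exp (L * C1) * Real.exp (L * C2) * C3 ^ (L - 1) with hB0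
  rcases Nat.eq_zero_or_pos L with hL0 | hL
  · exact ⟨1, one_pos, fun S x N _ h => by omega⟩
  have hL' : (0 : ℝ) < L := by exact_mod_cast hL
  have hκ' : 0 < κ' := by positivity
  have hC3p : 0 < C3 := by positivity
  have hB0p : 0 < B0 := by positivity
  refine ⟨B0 + 1 / (4 * κ), by positivity, ?_⟩
  intro S x N hx hSL hN s hs
  set m : ℕ := N / L with hm
  set r : ℕ := Nat.sqrt m with hr
  have hN' : (0 : ℝ) < N := by exact_mod_cast hN
  have hmN : m ≤ N := Nat.div_le_self _ _
  have hLm : L * m ≤ N := Nat.mul_div_le N L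
  have hNL : N ≤ L * (m + 1) := (Nat.lt_mul_div_succ N hL).le
  have hcardΛ : (insert x S).card = L := by rw [Finset.card_insert_of_notMem hx, hSL]
  set lam : ℝ := Real.log (c (m + 1)) with hlam
  set E0 : ℝ := L * s6F c m + lam * (N - L * m) with hE0
  have hlin : ∀ η : ℤ → ℕ, ∑ y ∈ insert x S, η y = N →
      ∑ y ∈ insert x S, lam * ((η y : ℝ) - m) = lam * (N - L * m) := by
    intro η hη
    rw [← Finset.mul_sum, Finset.sum_sub_distrib, Finset.sum_const, hcardΛ, nsmul_eq_mul]
    congr 2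
    exact_mod_cast hη
  have hconst : ∑ y ∈ insert x S, s6F c m = L * s6F c m := by
    rw [Finset.sum_const, hcardΛ, nsmul_eq_mul]
  have hWup : ∀ η ∈ Finset.piAntidiag (insert x S) N,
      s6W c (insert x S) η * Real.exp (s * |(η x : ℝ) - m|) ≤
        Real.exp (-E0 + L * C1 + N * s ^ 2 / (4 * κ)) *
          ∏ y ∈ S, Real.exp (-(κ * ((η y : ℝ) - m) ^ 2 / N)) := by
    intro η hη
    rw [Finset.mem_piAntidiag] at hη
    have hle : ∀ y ∈ insert x S, η y ≤ N := by
      intro y hy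
      rw [← hη.1]
      exact Finset.single_le_sum (f := η) (fun _ _ => Nat.zero_le _) hy
    have h1 : ∑ y ∈ insert x S, (lam * ((η y : ℝ) - m) + κ * ((η y : ℝ) - m) ^ 2 / N - C1) ≤
        ∑ y ∈ insert x S, (s6F c (η y) - s6F c m) :=
      Finset.sum_le_sum fun y hy => s6_F_lower c a₁ α β δ ha1 hα hβ hδ hcpos hl hc1 hc2
        L m N hN hL hmN hNL (η y) (hle y hy)
    rw [Finset.sum_sub_distrib, Finset.sum_sub_distrib, Finset.sum_add_distrib, hlin η hη.1,
      hconst, Finset.sum_const, hcardΛ, nsmul_eq_mul, Finset.sum_insert hx (f := fun y =>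
        κ * ((η y : ℝ) - m) ^ 2 / N)] at h1
    rw [s6W, ← Real.exp_sum, ← Real.exp_add, ← Real.exp_add]
    apply Real.exp_le_exp.2
    rw [Finset.sum_neg_distrib]
    set d := |(η x : ℝ) - m| with hd
    have h2 : s * d ≤ κ * ((η x : ℝ) - m) ^ 2 / N + N * s ^ 2 / (4 * κ) := by
      rw [← sq_abs ((η x : ℝ) - m), ← hd]
      have h3 : 0 ≤ (κ / N) * (d - N * s / (2 * κ)) ^ 2 := by positivity
      have h4 : (κ / N) * (d - N * s / (2 * κ)) ^ 2 =
        κ * d ^ 2 / N + N * s ^ 2 / (4 * κ) - s * d := by field_simp; ring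
      linarith
    linarith
  have hZ : ((r : ℝ) + 1) ^ S.card * Real.exp (-E0 - L * C2) ≤
      ∑ η ∈ Finset.piAntidiag (insert x S) N, s6W c (insert x S) η := by
    refine s6_sum_lower S x hx N m r (Nat.sqrt_le_self m) (by rw [hSL]; exact hLm)
      (by rw [hSL]; exact hNL) _ (fun η => (Real.exp_pos _).le) _ ?_
    intro η hη hS hxx
    apply Real.exp_le_exp.2
    have h1 : ∑ y ∈ insert x S, (s6F c (η y) - s6F c m) ≤
        ∑ y ∈ insert x S, (lam * ((η y : ℝ) - m) + C2) := by
      refine Finset.sum_le_sum fun y hy => ?_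
      rcases Finset.mem_insert.1 hy with rfl | hy
      · obtain ⟨i, hi, hie⟩ := hxx
        rw [hie]
        exact s6_F_upper_up c a₁ δ ha1 hδ hcpos hu hc2 L m i (by rw [← hSL]; exact hi)
      · obtain ⟨i, hi, hie⟩ := hS y hy
        rw [hie]
        exact s6_F_upper_down c a₁ δ ha1 hδ hcpos hu hc2 L m hL i hi
    rw [Finset.sum_sub_distrib, Finset.sum_add_distrib, hlin η hη,
      hconst, Finset.sum_const, hcardΛ, nsmul_eq_mul] at h1
    linarith
  have hR : (N : ℝ) / L ≤ ((r : ℝ) + 1) ^ 2 := by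
    rw [div_le_iff₀ hL']
    have h1 : m + 1 ≤ (r + 1) ^ 2 := by rw [sq]; exact Nat.lt_succ_sqrt m
    have h2 : N ≤ (r + 1) ^ 2 * L := hNL.trans (by rw [mul_comm]; gcongr)
    exact_mod_cast h2
  have hG : ∑ k ∈ Finset.range (N + 1), Real.exp (-(κ * ((k : ℝ) - m) ^ 2 / N)) ≤
      C3 * ((r : ℝ) + 1) := by
    have := s6_gauss κ' hκ' ((r : ℝ) + 1) (N / L) (by positivity) (by simp) hR m (N + 1)
    refine le_trans (le_of_eq ?_) this
    refine Finset.sum_congr rfl fun k _ => ?_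
    congr 2
    rw [hκ'def]; field_simp
  have hnum : ∑ η ∈ Finset.piAntidiag (insert x S) N,
      s6W c (insert x S) η * Real.exp (s * |(η x : ℝ) - m|) ≤
      Real.exp (-E0 + L * C1 + N * s ^ 2 / (4 * κ)) * (C3 * ((r : ℝ) + 1)) ^ S.card := by
    refine (Finset.sum_le_sum hWup).trans ?_
    rw [← Finset.mul_sum]
    gcongr
    refine (s6_sum_upper S x hx N (fun k => Real.exp (-(κ * ((k : ℝ) - m) ^ 2 / N)))
      (fun _ => (Real.exp_pos _).le)).trans ?_
    exact pow_le_pow_left₀ (Finset.sum_nonneg fun _ _ => (Real.exp_pos _).le) hG _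
  have hZpos : 0 < ((r : ℝ) + 1) ^ S.card * Real.exp (-E0 - L * C2) := by positivity
  rw [s6_wE c hcpos, div_le_iff₀ (hZpos.trans_le hZ)]
  refine hnum.trans ?_
  have hcard : S.card = L - 1 := by omega
  have e1 : Real.exp (-E0 + L * C1 + N * s ^ 2 / (4 * κ)) * (C3 * ((r : ℝ) + 1)) ^ S.card =
      B0 * Real.exp (1 / (4 * κ) * (N * s ^ 2)) *
        (((r : ℝ) + 1) ^ S.card * Real.exp (-E0 - L * C2)) := by
    have : Real.exp (-E0 + L * C1 + N * s ^ 2 / (4 * κ)) =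
        Real.exp (L * C1) * Real.exp (L * C2) * Real.exp (1 / (4 * κ) * (N * s ^ 2)) *
          Real.exp (-E0 - L * C2) := by
      rw [← Real.exp_add, ← Real.exp_add, ← Real.exp_add]; congr 1; ring
    rw [this, hB0, mul_pow, ← hcard]; ring
  rw [e1]
  have hpos1 : 0 ≤ 1 / (4 * κ) := by positivity
  gcongr
  · linarith
  · linarith

lemma s6_h (c : ℕ → ℝ) (a₁ δ : ℝ) (ha1 : 0 < a₁) (hδ : 0 < δ)
    (hcpos : ∀ n : ℕ, 0 < n → 0 < c n)
    (hu : ∀ j d : ℕ, |c (j + d) - c j| ≤ a₁ * d)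
    (hc1 : ∀ k : ℕ, c k ≤ a₁ * k) (hc2 : ∀ k : ℕ, δ * k ≤ c k) (n m : ℕ) :
    |hfun c n - hfun c m| ≤ 2 * a₁ / δ ^ 2 * |(n : ℝ) - m| / (m + 1) := by
  have hu' : |c (n + 1) - c (m + 1)| ≤ a₁ * |(n : ℝ) - m| := by
    rcases le_total m n with h | h
    · obtain ⟨i, rfl⟩ := Nat.exists_eq_add_of_le h
      have := hu (m + 1) i
      rw [show ((m + i : ℕ) : ℝ) - m = i by push_cast; ring, Nat.abs_cast,
        show m + i + 1 = m + 1 + i by ring]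
      exact this
    · obtain ⟨i, rfl⟩ := Nat.exists_eq_add_of_le h
      have := hu (n + 1) i
      rw [show (n : ℝ) - ((n + i : ℕ) : ℝ) = -i by push_cast; ring, abs_neg, Nat.abs_cast,
        show n + i + 1 = n + 1 + i by ring, abs_sub_comm]
      exact this
  have hn := hcpos (n + 1) (by omega)
  have hm := hcpos (m + 1) (by omega)
  have hn2 : δ * (n + 1) ≤ c (n + 1) := by simpa using hc2 (n + 1)
  have hm2 : δ * (m + 1) ≤ c (m + 1) := by simpa using hc2 (m + 1)
  have hn1 : c (n + 1) ≤ a₁ * (n + 1) := by simpa using hc1 (n + 1)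
  have e : hfun c n - hfun c m =
      (((n : ℝ) + 1) * (c (m + 1) - c (n + 1)) + ((n : ℝ) - m) * c (n + 1)) /
        (c (n + 1) * c (m + 1)) := by
    unfold hfun; field_simp; ring
  rw [e, abs_div, abs_of_pos (mul_pos hn hm)]
  have h1 : |((n : ℝ) + 1) * (c (m + 1) - c (n + 1)) + ((n : ℝ) - m) * c (n + 1)| ≤
      (n + 1) * (2 * a₁ * |(n : ℝ) - m|) := by
    refine (abs_add_le _ _).trans ?_
    rw [abs_mul, abs_mul, abs_of_pos hn, abs_of_nonneg (by positivity : (0 : ℝ) ≤ n + 1),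
      abs_sub_comm (c (m + 1))]
    have h2 : ((n : ℝ) + 1) * |c (n + 1) - c (m + 1)| ≤ (n + 1) * (a₁ * |(n : ℝ) - m|) := by gcongr
    have h3 : |(n : ℝ) - m| * c (n + 1) ≤ |(n : ℝ) - m| * (a₁ * (n + 1)) := by gcongr
    linarith
  calc _ ≤ (n + 1) * (2 * a₁ * |(n : ℝ) - m|) / ((δ * (n + 1)) * (δ * (m + 1))) := by gcongr
    _ = _ := by field_simp

/-- Proposition 3.5, inequality (3.22): exponential moment bound for `N h(η_x)`
under the canonical measure. -/
theorem statement6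
    (c : ℕ → ℝ) (a₁ a₂ : ℝ) (k₀ : ℕ)
    (hc0 : c 0 = 0) (hcpos : ∀ n : ℕ, 0 < n → 0 < c n)
    (hLG : ∀ k : ℕ, |c (k + 1) - c k| ≤ a₁)
    (hk₀ : 0 < k₀) (ha₂ : 0 < a₂)
    (hM : ∀ j k : ℕ, j + k₀ ≤ k → a₂ ≤ c k - c j)
    (L : ℕ) (hL : 1 ≤ L) :
    ∃ A : ℝ, 0 < A ∧ ∀ (a : ℤ) (x : ℤ) (N : ℕ), x ∈ Finset.Ico a (a + (L : ℤ)) → 1 ≤ N →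
      ∀ t : ℝ, -1 ≤ t → t ≤ 1 →
        wE (nuW c (Finset.Ico a (a + (L : ℤ))) N)
          (fun η => Real.exp (t * (N : ℝ) * (hfun c (η x) -
            wE (nuW c (Finset.Ico a (a + (L : ℤ))) N) (fun ξ => hfun c (ξ x)))))
        ≤ A * Real.exp (A * ((N : ℝ) * t ^ 2 + Real.sqrt (N : ℝ) * |t|)) := by
  have ha1' : 0 ≤ a₁ := le_trans (abs_nonneg _) (hLG 0)
  have hu := s6_upper c a₁ hLG
  have hc1 : ∀ k : ℕ, c k ≤ a₁ * k := fun k => by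
    have := (abs_le.1 (hu 0 k)).2
    simpa [hc0] using this
  have ha1 : 0 < a₁ := by
    have h1 := hcpos 1 one_pos
    have h2 := hc1 1
    simp at h2; linarith
  have hk : (0 : ℝ) < k₀ := by exact_mod_cast hk₀
  have hl := s6_lower c a₁ a₂ k₀ hLG hk₀ ha₂ hM
  have hα : 0 < a₂ / k₀ := by positivity
  have hβ : 0 < a₁ * k₀ + a₂ := by positivity
  obtain ⟨δ, hδ, hc2⟩ := s6_delta c _ _ hα hc0 hcpos (fun d => by simpa [hc0] using hl 0 d)
  obtain ⟨B, hB, hkey⟩ := s6_key c a₁ _ _ δ ha1 hα hβ hδ hcpos hu hl hc1 hc2 L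
  have hh := s6_h c a₁ δ ha1 hδ hcpos hu hc1 hc2
  have hL' : (0 : ℝ) < L := by exact_mod_cast hL
  set C : ℝ := 2 * a₁ / δ ^ 2 * L with hC
  have hCp : 0 < C := by positivity
  refine ⟨B + B * C ^ 2 + C * (B * Real.exp B), by positivity, ?_⟩
  intro a x N hx hN t ht1 ht2
  have hN' : (0 : ℝ) < N := by exact_mod_cast hN
  obtain ⟨S, hxS, hΛ⟩ : ∃ S : Finset ℤ, x ∉ S ∧ insert x S = Finset.Ico a (a + (L : ℤ)) :=
    ⟨(Finset.Ico a (a + (L : ℤ))).erase x, Finset.notMem_erase _ _, Finset.insert_erase hx⟩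
  have hcard : S.card + 1 = L := by
    rw [← Finset.card_insert_of_notMem hxS, hΛ]; simp
  rw [← hΛ]
  have hk := hkey S x N hxS hcard hN
  set m : ℕ := N / L with hm
  have hNL : (N : ℝ) ≤ L * (m + 1) := by
    exact_mod_cast (Nat.lt_mul_div_succ N hL).le
  have hNh : ∀ n : ℕ, N * |hfun c n - hfun c m| ≤ C * |(n : ℝ) - m| := by
    intro n
    calc N * |hfun c n - hfun c m| ≤ (L * (m + 1)) * (2 * a₁ / δ ^ 2 * |(n : ℝ) - m| / (m + 1)) := by
          gcongr; exact hh n m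
      _ = _ := by rw [hC]; field_simp
  set P := Finset.piAntidiag (insert x S) N with hP
  set W := s6W c (insert x S) with hW
  have hWp : ∀ η, 0 < W η := fun η => Real.exp_pos _
  set Z := ∑ η ∈ P, W η with hZ
  have hwE : ∀ f, wE (nuW c (insert x S) N) f = (∑ η ∈ P, W η * f η) / Z :=
    s6_wE c hcpos (insert x S) N
  have hZp : 0 < Z := by
    refine Finset.sum_pos (fun η _ => hWp η) ⟨fun z => if z = x then N else 0, ?_⟩
    rw [hP, Finset.mem_piAntidiag]
    constructor
    · simp
    · intro i hi
      by_cases h : i = x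
      · simp [h]
      · simp [h] at hi
  set M := wE (nuW c (insert x S) N) (fun ξ => hfun c (ξ x)) with hMdef
  set sq := Real.sqrt (N : ℝ) with hsq
  have hsqp : 0 < sq := Real.sqrt_pos.2 hN'
  have hsqq : sq ^ 2 = N := Real.sq_sqrt hN'.le
  have hmom : (∑ η ∈ P, W η * |(η x : ℝ) - m|) / Z ≤ sq * (B * Real.exp B) := by
    have h1 := hk (1 / sq) (by positivity)
    rw [hwE] at h1
    have h2 : (N : ℝ) * (1 / sq) ^ 2 = 1 := by rw [← hsqq]; field_simp
    rw [h2, mul_one] at h1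
    calc (∑ η ∈ P, W η * |(η x : ℝ) - m|) / Z
        ≤ (∑ η ∈ P, sq * (W η * Real.exp (1 / sq * |(η x : ℝ) - m|))) / Z := by
          refine div_le_div_of_nonneg_right (Finset.sum_le_sum fun η hη => ?_) hZp.le
          have h3 := Real.add_one_le_exp (1 / sq * |(η x : ℝ) - m|)
          have h4 : |(η x : ℝ) - m| ≤ sq * Real.exp (1 / sq * |(η x : ℝ) - m|) := by
            calc |(η x : ℝ) - m| = sq * (1 / sq * |(η x : ℝ) - m|) := by field_simp
              _ ≤ _ := by gcongr; linarith
          calc W η * |(η x : ℝ) - m| ≤ W η * (sq * Real.exp (1 / sq * |(η x : ℝ) - m|)) :=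
                mul_le_mul_of_nonneg_left h4 (hWp η).le
            _ = _ := by ring
      _ = sq * ((∑ η ∈ P, W η * Real.exp (1 / sq * |(η x : ℝ) - m|)) / Z) := by
          rw [← Finset.mul_sum, mul_div_assoc]
      _ ≤ _ := by gcongr
  have hmean : N * |M - hfun c m| ≤ C * (sq * (B * Real.exp B)) := by
    have e : M - hfun c m = (∑ η ∈ P, W η * (hfun c (η x) - hfun c m)) / Z := by
      rw [hMdef, hwE]
      simp only [mul_sub, Finset.sum_sub_distrib]
      rw [← Finset.sum_mul, ← hZ, sub_div, mul_div_cancel_left₀ _ hZp.ne']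
    rw [e, abs_div, abs_of_pos hZp, ← mul_div_assoc]
    calc N * |∑ η ∈ P, W η * (hfun c (η x) - hfun c m)| / Z
        ≤ N * (∑ η ∈ P, |W η * (hfun c (η x) - hfun c m)|) / Z := by
          gcongr; exact Finset.abs_sum_le_sum_abs _ _
      _ = (∑ η ∈ P, W η * (N * |hfun c (η x) - hfun c m|)) / Z := by
          rw [Finset.mul_sum]
          congr 1
          refine Finset.sum_congr rfl fun η _ => ?_
          rw [abs_mul, abs_of_pos (hWp η)]; ring
      _ ≤ (∑ η ∈ P, C * (W η * |(η x : ℝ) - m|)) / Z := by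
          refine div_le_div_of_nonneg_right (Finset.sum_le_sum fun η hη => ?_) hZp.le
          calc _ ≤ W η * (C * |(η x : ℝ) - m|) :=
                mul_le_mul_of_nonneg_left (hNh _) (hWp η).le
            _ = _ := by ring
      _ = C * ((∑ η ∈ P, W η * |(η x : ℝ) - m|) / Z) := by
          rw [← Finset.mul_sum, mul_div_assoc]
      _ ≤ _ := by gcongr
  have hfin := hk (|t| * C) (by positivity)
  rw [hwE] at hfin ⊢
  calc (∑ η ∈ P, W η * Real.exp (t * N * (hfun c (η x) - M))) / Z
      ≤ (∑ η ∈ P, Real.exp (|t| * (C * (sq * (B * Real.exp B)))) *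
          (W η * Real.exp (|t| * C * |(η x : ℝ) - m|))) / Z := by
        refine div_le_div_of_nonneg_right (Finset.sum_le_sum fun η hη => ?_) hZp.le
        rw [mul_left_comm (Real.exp _), ← Real.exp_add]
        refine mul_le_mul_of_nonneg_left (Real.exp_le_exp.2 ?_) (hWp η).le
        have h1 := hNh (η x)
        calc t * N * (hfun c (η x) - M) ≤ |t * N * (hfun c (η x) - M)| := le_abs_self _
          _ = |t| * (N * |hfun c (η x) - M|) := by
            rw [abs_mul, abs_mul, Nat.abs_cast]; ring
          _ ≤ |t| * (C * (sq * (B * Real.exp B)) + C * |(η x : ℝ) - m|) := by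
            gcongr
            have h2 : |hfun c (η x) - M| ≤ |hfun c (η x) - hfun c m| + |M - hfun c m| := by
              rw [abs_sub_comm M]; exact abs_sub_le _ _ _
            calc _ ≤ N * (|hfun c (η x) - hfun c m| + |M - hfun c m|) := by gcongr
              _ ≤ _ := by linarith
          _ = _ := by ring
    _ = Real.exp (|t| * (C * (sq * (B * Real.exp B)))) *
          ((∑ η ∈ P, W η * Real.exp (|t| * C * |(η x : ℝ) - m|)) / Z) := by
        rw [← Finset.mul_sum, mul_div_assoc]
    _ ≤ Real.exp (|t| * (C * (sq * (B * Real.exp B)))) *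
          (B * Real.exp (B * (N * (|t| * C) ^ 2))) := by gcongr
    _ = B * Real.exp (C * (B * Real.exp B) * (sq * |t|) + B * C ^ 2 * (N * t ^ 2)) := by
        rw [mul_left_comm, ← Real.exp_add, mul_pow, sq_abs]; congr 2; ring
    _ ≤ _ := by
        have p1 : 0 ≤ C * (B * Real.exp B) := by positivity
        have p2 : 0 ≤ B * C ^ 2 := by positivity
        have p3 : 0 ≤ sq * |t| := by positivity
        have p4 : 0 ≤ N * t ^ 2 := by positivity
        gcongr
        · linarith
        · nlinarith [mul_nonneg p1 p4, mul_nonneg p2 p3, mul_nonneg hB.le p3, mul_nonneg hB.le p4]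
end
end

section
/- For every L there exists a constant C_L (depending only on L) such that for every segment Λ ⊂ ℤ with |Λ| = L, every N ≥ 1 and every f ≥ 0, ν_Λ^N[ f , Σ_{x∈Λ} c(η_x) ]² ≤ C_L N ν_Λ^N[f] Ent_{ν_Λ^N}(f). -/
open scoped BigOperators

noncomputable section

lemma zr_cfact_pos {c : ℕ → ℝ} (hcpos : ∀ n : ℕ, 0 < n → 0 < c n) (k : ℕ) : 0 < cfact c k := by
  induction k with
  | zero => simp [cfact]
  | succ k ih => rw [cfact]; exact mul_pos ih (hcpos _ (Nat.succ_pos _))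

lemma zr_sum_split {Λ : Finset ℤ} {x y : ℤ} (hx : x ∈ Λ) (hy : y ∈ Λ) (hxy : x ≠ y) (h : ℤ → ℕ) :
    ∑ z ∈ Λ, h z = h x + (h y + ∑ z ∈ (Λ.erase x).erase y, h z) := by
  rw [Finset.add_sum_erase _ _ (Finset.mem_erase.2 ⟨hxy.symm, hy⟩), Finset.add_sum_erase _ _ hx]

lemma zr_prod_split {Λ : Finset ℤ} {x y : ℤ} (hx : x ∈ Λ) (hy : y ∈ Λ) (hxy : x ≠ y) (h : ℤ → ℝ) :
    ∏ z ∈ Λ, h z = h x * (h y * ∏ z ∈ (Λ.erase x).erase y, h z) := by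
  rw [Finset.mul_prod_erase _ _ (Finset.mem_erase.2 ⟨hxy.symm, hy⟩), Finset.mul_prod_erase _ _ hx]

lemma zr_move_x (η : ℤ → ℕ) (x y : ℤ) : move η x y x = η x - 1 := by simp [move]

lemma zr_move_y (η : ℤ → ℕ) {x y : ℤ} (hxy : x ≠ y) : move η x y y = η y + 1 := by
  simp [move, hxy.symm]

lemma zr_move_z (η : ℤ → ℕ) {x y z : ℤ} (hx : z ≠ x) (hy : z ≠ y) : move η x y z = η z := by
  simp [move, hx, hy]

lemma zr_move_move (η : ℤ → ℕ) {x y : ℤ} (hxy : x ≠ y) (h : 0 < η x) :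
    move (move η x y) y x = η := by
  funext z
  by_cases hz : z = y
  · subst hz; rw [zr_move_x, zr_move_y _ hxy]; omega
  · by_cases hzx : z = x
    · subst hzx; rw [zr_move_y _ hxy.symm, zr_move_x]; omega
    · rw [zr_move_z _ hz hzx, zr_move_z _ hzx hz]

lemma zr_move_mem {Λ : Finset ℤ} {N : ℕ} {x y : ℤ} (hx : x ∈ Λ) (hy : y ∈ Λ) (hxy : x ≠ y)
    {η : ℤ → ℕ} (hη : η ∈ Λ.piAntidiag N) (h : 0 < η x) : move η x y ∈ Λ.piAntidiag N := by
  rw [Finset.mem_piAntidiag] at hη ⊢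
  obtain ⟨h1, h2⟩ := hη
  constructor
  · rw [← h1]
    change ∑ z ∈ Λ, move η x y z = ∑ z ∈ Λ, η z
    rw [zr_sum_split hx hy hxy, zr_sum_split hx hy hxy η, zr_move_x, zr_move_y _ hxy]
    rw [Finset.sum_congr rfl (g := fun z => η z)]
    · omega
    · intro z hz
      simp only [Finset.mem_erase] at hz
      exact zr_move_z _ hz.2.1 hz.1
  · intro z hz
    by_cases hzx : z = x
    · rwa [hzx]
    · by_cases hzy : z = y
      · rwa [hzy]
      · rw [zr_move_z _ hzx hzy] at hz; exact h2 z hz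

lemma zr_weight {c : ℕ → ℝ} (hcpos : ∀ n : ℕ, 0 < n → 0 < c n)
    {Λ : Finset ℤ} {x y : ℤ} (hx : x ∈ Λ) (hy : y ∈ Λ) (hxy : x ≠ y)
    {η : ℤ → ℕ} (h : 0 < η x) :
    (∏ z ∈ Λ, (cfact c (η z))⁻¹) * c (η x) =
      (∏ z ∈ Λ, (cfact c (move η x y z))⁻¹) * c (move η x y y) := by
  rw [zr_prod_split hx hy hxy, zr_prod_split hx hy hxy (fun z => (cfact c (move η x y z))⁻¹)]
  rw [zr_move_x, zr_move_y _ hxy]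
  rw [Finset.prod_congr rfl (f := fun z => (cfact c (move η x y z))⁻¹)
    (g := fun z => (cfact c (η z))⁻¹)]
  · obtain ⟨k, hk⟩ : ∃ k, η x = k + 1 := ⟨η x - 1, by omega⟩
    rw [hk, Nat.add_sub_cancel, cfact, cfact]
    have h1 := (zr_cfact_pos hcpos k).ne'
    have h2 := (zr_cfact_pos hcpos (η y)).ne'
    have h3 := (hcpos (k + 1) (Nat.succ_pos _)).ne'
    have h4 := (hcpos (η y + 1) (Nat.succ_pos _)).ne'
    field_simp
  · intro z hz
    simp only [Finset.mem_erase] at hz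
    rw [zr_move_z _ hz.2.1 hz.1]

lemma zr_rev {c : ℕ → ℝ} (hc0 : c 0 = 0) (hcpos : ∀ n : ℕ, 0 < n → 0 < c n)
    {Λ : Finset ℤ} (N : ℕ) {x y : ℤ} (hx : x ∈ Λ) (hy : y ∈ Λ) (hxy : x ≠ y)
    (g : (ℤ → ℕ) → ℝ) :
    ∑ η ∈ Λ.piAntidiag N, (∏ z ∈ Λ, (cfact c (η z))⁻¹) * c (η x) * g (move η x y) =
      ∑ η ∈ Λ.piAntidiag N, (∏ z ∈ Λ, (cfact c (η z))⁻¹) * c (η y) * g η := by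
  have key : ∀ (u : ℤ) (G : (ℤ → ℕ) → ℝ),
      ∑ η ∈ Λ.piAntidiag N, (∏ z ∈ Λ, (cfact c (η z))⁻¹) * c (η u) * G η =
      ∑ η ∈ (Λ.piAntidiag N).filter (fun η => 0 < η u),
        (∏ z ∈ Λ, (cfact c (η z))⁻¹) * c (η u) * G η := by
    intro u G
    symm
    apply Finset.sum_filter_of_ne
    intro η _ hne
    rcases Nat.eq_zero_or_pos (η u) with h | h
    · rw [h, hc0] at hne; simp at hne
    · exact h
  rw [key x (fun η => g (move η x y)), key y g]
  refine Finset.sum_nbij' (fun η => move η x y) (fun η => move η y x) ?_ ?_ ?_ ?_ ?_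
  · intro η hη
    rw [Finset.mem_filter] at hη ⊢
    refine ⟨zr_move_mem hx hy hxy hη.1 hη.2, ?_⟩
    rw [zr_move_y _ hxy]; omega
  · intro η hη
    rw [Finset.mem_filter] at hη ⊢
    refine ⟨zr_move_mem hy hx hxy.symm hη.1 hη.2, ?_⟩
    rw [zr_move_y _ hxy.symm]; omega
  · intro η hη
    rw [Finset.mem_filter] at hη
    exact zr_move_move η hxy hη.2
  · intro η hη
    rw [Finset.mem_filter] at hη
    exact zr_move_move η hxy.symm hη.2
  · intro η hη
    rw [Finset.mem_filter] at hη
    rw [zr_weight hcpos hx hy hxy hη.2]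

/-- abstract entropy lemma for a normalized density -/
lemma zr_log_ineq {x : ℝ} (hx : 0 ≤ x) : (x - 1) ^ 2 ≤ 2 * (x + 1) * (x * Real.log x - x + 1) := by
  have h0 : (Real.sqrt x - 1) ^ 2 ≤ x * Real.log x - x + 1 := by
    rcases hx.eq_or_lt with h | h
    · rw [← h]; simp
    · have hs : 0 < Real.sqrt x := Real.sqrt_pos.2 h
      have h1 := Real.one_sub_inv_le_log_of_pos hs
      rw [Real.log_sqrt hx] at h1
      have h2 : Real.sqrt x * Real.sqrt x = x := Real.mul_self_sqrt hx
      have h3 : x * (1 - (Real.sqrt x)⁻¹) = x - Real.sqrt x := by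
        nth_rewrite 1 [← h2]
        field_simp
        nlinarith
      have h4 := mul_le_mul_of_nonneg_left h1 hx
      nlinarith
  have h2 : Real.sqrt x * Real.sqrt x = x := Real.mul_self_sqrt hx
  have h3 : (x - 1) ^ 2 = (Real.sqrt x - 1) ^ 2 * (Real.sqrt x + 1) ^ 2 := by
    nth_rewrite 1 [← h2]; ring
  rw [h3]
  have h4 : (Real.sqrt x + 1) ^ 2 ≤ 2 * (x + 1) := by nlinarith [sq_nonneg (Real.sqrt x - 1)]
  calc _ ≤ (x * Real.log x - x + 1) * (2 * (x + 1)) :=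
        mul_le_mul h0 h4 (sq_nonneg _) (le_trans (sq_nonneg _) h0)
    _ = _ := by ring

lemma zr_young {x : ℝ} (hx : 0 ≤ x) (b : ℝ) : x * b ≤ x * Real.log x - x + Real.exp b := by
  rcases hx.eq_or_lt with h | h
  · rw [← h]; simp [Real.exp_nonneg]
  · have h1 := Real.add_one_le_exp (b - Real.log x)
    rw [Real.exp_sub, Real.exp_log h] at h1
    rw [le_div_iff₀ h] at h1
    nlinarith

/-- entropy inequality, normalized. -/
lemma zr_abstract {ι : Type*} (P : Finset ι) (μ f g : ι → ℝ) (B K : ℝ) (hB : 0 ≤ B) (hK : 0 ≤ K)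
    (hμ : ∀ i ∈ P, 0 ≤ μ i) (hμ1 : ∑ i ∈ P, μ i = 1) (hf : ∀ i ∈ P, 0 ≤ f i)
    (hf1 : ∑ i ∈ P, μ i * f i = 1)
    (h1 : ∑ i ∈ P, μ i * (f i * g i ^ 2) ≤ B * (∑ i ∈ P, μ i * (f i * Real.log (f i)) + K))
    (h2 : ∑ i ∈ P, μ i * g i ^ 2 ≤ B * K) :
    (∑ i ∈ P, μ i * ((f i - 1) * g i)) ^ 2 ≤
      2 * B * (1 + 2 * K) * ∑ i ∈ P, μ i * (f i * Real.log (f i)) := by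
  set E := ∑ i ∈ P, μ i * (f i * Real.log (f i)) with hE
  have hE' : ∑ i ∈ P, μ i * (f i * Real.log (f i) - f i + 1) = E := by
    have : ∀ i, μ i * (f i * Real.log (f i) - f i + 1) =
      μ i * (f i * Real.log (f i)) - μ i * f i + μ i := fun i => by ring
    simp only [this, Finset.sum_add_distrib, Finset.sum_sub_distrib]
    rw [hμ1, hf1]; ring
  have hloc : ∀ i ∈ P, 0 ≤ f i * Real.log (f i) - f i + 1 := by
    intro i hi
    have := zr_log_ineq (hf i hi)
    have h3 := hf i hi
    by_contra hneg
    push Not at hneg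
    nlinarith [sq_nonneg (f i - 1)]
  have hE0 : 0 ≤ E := by
    rw [← hE']
    exact Finset.sum_nonneg fun i hi => mul_nonneg (hμ i hi) (hloc i hi)
  have hsum : ∑ i ∈ P, μ i * ((f i + 1) * g i ^ 2) ≤ B * (E + 2 * K) := by
    have : ∀ i, μ i * ((f i + 1) * g i ^ 2) =
      μ i * (f i * g i ^ 2) + μ i * g i ^ 2 := fun i => by ring
    simp only [this, Finset.sum_add_distrib]
    linarith
  rcases le_total E 1 with hc | hc
  · have hcs := Finset.sum_sq_le_sum_mul_sum_of_sq_le_mul P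
      (r := fun i => μ i * ((f i - 1) * g i))
      (f := fun i => μ i * (f i * Real.log (f i) - f i + 1))
      (g := fun i => 2 * (μ i * ((f i + 1) * g i ^ 2)))
      (fun i hi => mul_nonneg (hμ i hi) (hloc i hi))
      (fun i hi => by
        have := hμ i hi
        have := hf i hi
        positivity)
      (fun i hi => by
        have := zr_log_ineq (hf i hi)
        have h5 := mul_le_mul_of_nonneg_left this (by positivity : 0 ≤ μ i ^ 2 * g i ^ 2)
        nlinarith)
    rw [hE', ← Finset.mul_sum] at hcs
    refine hcs.trans ?_
    have h6 : E * (2 * ∑ i ∈ P, μ i * ((f i + 1) * g i ^ 2)) ≤ E * (2 * (B * (E + 2 * K))) := by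
      gcongr
    refine h6.trans ?_
    have h7 : B * (E + 2 * K) ≤ B * (1 + 2 * K) := by gcongr
    nlinarith
  · have hcs := Finset.sum_sq_le_sum_mul_sum_of_sq_le_mul P
      (r := fun i => μ i * ((f i - 1) * g i))
      (f := fun i => μ i * (f i + 1))
      (g := fun i => (μ i * ((f i + 1) * g i ^ 2)))
      (fun i hi => mul_nonneg (hμ i hi) (by linarith [hf i hi]))
      (fun i hi => by
        have := hμ i hi
        have := hf i hi
        positivity)
      (fun i hi => by
        have h5 : (f i - 1) ^ 2 ≤ (f i + 1) ^ 2 := by nlinarith [hf i hi]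
        have h5 := mul_le_mul_of_nonneg_left h5 (by positivity : 0 ≤ μ i ^ 2 * g i ^ 2)
        nlinarith)
    have h2' : ∑ i ∈ P, μ i * (f i + 1) = 2 := by
      simp only [mul_add, mul_one, Finset.sum_add_distrib]
      rw [hμ1, hf1]; norm_num
    rw [h2'] at hcs
    refine hcs.trans ?_
    have h7 : E + 2 * K ≤ (1 + 2 * K) * E := by nlinarith
    have h8 := mul_le_mul_of_nonneg_left h7 hB
    nlinarith

lemma zr_growth {c : ℕ → ℝ} {a₂ : ℝ} {k₀ : ℕ}
    (hM : ∀ j k : ℕ, j + k₀ ≤ k → a₂ ≤ c k - c j) (q : ℕ) :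
    ∀ j k : ℕ, j + (q + 1) * k₀ ≤ k → a₂ * ((q : ℝ) + 1) ≤ c k - c j := by
  induction q with
  | zero => intro j k h; simpa using hM j k (by simpa using h)
  | succ q ih =>
    intro j k h
    have h1 := ih j (j + (q + 1) * k₀) le_rfl
    have h2 := hM (j + (q + 1) * k₀) k (by nlinarith)
    push_cast
    linarith

lemma zr_lip {c : ℕ → ℝ} {a₁ : ℝ} (hLG : ∀ k : ℕ, |c (k + 1) - c k| ≤ a₁) (j d : ℕ) :
    |c (j + d) - c j| ≤ a₁ * d := by
  induction d with
  | zero => simp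
  | succ d ih =>
    have h := hLG (j + d)
    rw [← add_assoc]
    push_cast
    rw [abs_le] at *
    constructor <;> linarith [h.1, h.2, ih.1, ih.2]

lemma zr_lip' {c : ℕ → ℝ} {a₁ : ℝ} (hLG : ∀ k : ℕ, |c (k + 1) - c k| ≤ a₁) (j k : ℕ) :
    |c j - c k| ≤ a₁ * |(j : ℝ) - k| := by
  rcases le_total j k with h | h
  · obtain ⟨d, rfl⟩ := Nat.exists_eq_add_of_le h
    have := zr_lip hLG j d
    rw [abs_sub_comm] at this
    push_cast
    simpa using this
  · obtain ⟨d, rfl⟩ := Nat.exists_eq_add_of_le h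
    have := zr_lip hLG k d
    push_cast
    simpa using this

lemma zr_drift0 {c : ℕ → ℝ} {a₁ a₂ : ℝ} {k₀ : ℕ}
    (hLG : ∀ k : ℕ, |c (k + 1) - c k| ≤ a₁) (ha₁ : 0 < a₁)
    (hk₀ : 0 < k₀) (ha₂ : 0 < a₂)
    (hM : ∀ j k : ℕ, j + k₀ ≤ k → a₂ ≤ c k - c j) (j d : ℕ) :
    a₂ / k₀ * (d : ℝ) ^ 2 - a₂ * d - a₁ * k₀ ^ 2 ≤ d * (c (j + d) - c j) := by
  have hk : (0 : ℝ) < k₀ := by exact_mod_cast hk₀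
  rcases lt_or_ge d k₀ with h | h
  · have h1 := (abs_le.1 (zr_lip hLG j d)).1
    have hd : (d : ℝ) ≤ k₀ := by exact_mod_cast h.le
    have hd0 : (0 : ℝ) ≤ d := Nat.cast_nonneg d
    have h2 : a₂ / k₀ * (d : ℝ) ^ 2 ≤ a₂ * d := by
      rw [div_mul_eq_mul_div, div_le_iff₀ hk]
      have := mul_le_mul_of_nonneg_left hd (by positivity : 0 ≤ a₂ * d)
      nlinarith
    have h3 : -(a₁ * k₀ ^ 2) ≤ d * (c (j + d) - c j) := by
      have h4 := mul_le_mul_of_nonneg_left h1 hd0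
      have h5 : (d : ℝ) ^ 2 ≤ k₀ ^ 2 := by gcongr
      have := mul_le_mul_of_nonneg_left h5 ha₁.le
      nlinarith
    linarith
  · obtain ⟨q, hq⟩ : ∃ q, d / k₀ = q + 1 :=
      ⟨d / k₀ - 1, by have := Nat.div_pos h hk₀; omega⟩
    have hdm := Nat.div_add_mod d k₀
    have hml := Nat.mod_lt d hk₀
    rw [hq] at hdm
    have h1 := zr_growth hM q j (j + d) (by rw [mul_comm]; omega)
    have h2 : (d : ℝ) ≤ k₀ * (q + 1) + k₀ := by
      have : d ≤ k₀ * (q + 1) + k₀ := by omega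
      exact_mod_cast this
    have h3 : (d : ℝ) / k₀ - 1 ≤ q + 1 := by
      rw [sub_le_iff_le_add, div_le_iff₀ hk]; nlinarith
    have h4 := mul_le_mul_of_nonneg_left h3 ha₂.le
    have h5 := mul_le_mul_of_nonneg_left (h4.trans h1) (Nat.cast_nonneg (α := ℝ) d)
    have h6 : (d : ℝ) * (a₂ * (d / k₀ - 1)) = a₂ / k₀ * (d : ℝ) ^ 2 - a₂ * d := by ring
    have : 0 ≤ a₁ * (k₀ : ℝ) ^ 2 := by positivity
    linarith

lemma zr_drift {c : ℕ → ℝ} {a₁ a₂ : ℝ} {k₀ : ℕ}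
    (hLG : ∀ k : ℕ, |c (k + 1) - c k| ≤ a₁) (ha₁ : 0 < a₁)
    (hk₀ : 0 < k₀) (ha₂ : 0 < a₂)
    (hM : ∀ j k : ℕ, j + k₀ ≤ k → a₂ ≤ c k - c j) (j k : ℕ) :
    a₂ / k₀ * ((j : ℝ) - k) ^ 2 - a₂ * |(j : ℝ) - k| - a₁ * k₀ ^ 2
      ≤ ((j : ℝ) - k) * (c j - c k) := by
  rcases le_total j k with h | h
  · obtain ⟨d, rfl⟩ := Nat.exists_eq_add_of_le h
    have := zr_drift0 hLG ha₁ hk₀ ha₂ hM j d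
    have e : (j : ℝ) - ((j + d : ℕ) : ℝ) = -d := by push_cast; ring
    rw [e, abs_neg, Nat.abs_cast]
    nlinarith
  · obtain ⟨d, rfl⟩ := Nat.exists_eq_add_of_le h
    have := zr_drift0 hLG ha₁ hk₀ ha₂ hM k d
    have e : ((k + d : ℕ) : ℝ) - (k : ℝ) = d := by push_cast; ring
    rw [e, Nat.abs_cast]
    nlinarith

lemma zr_point {θ N A B s a₁ a₂ k : ℝ} (hN : 1 ≤ N) (hA : 0 ≤ A) (hB : 0 ≤ B)
    (hA' : A ≤ a₁ * N) (hB' : B ≤ a₁ * N) (hs : |s| ≤ N) (ha₁ : 0 < a₁) (ha₂ : 0 < a₂) (hk : 0 < k)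
    (hθ : 0 < θ) (hθ1 : θ ≤ 1 / 8) (hθ2 : θ * (16 * a₁ * k) ≤ a₂)
    (hd : a₂ / k * s ^ 2 - a₂ * |s| - a₁ * k ^ 2 ≤ s * (A - B)) :
    A * (Real.exp (θ * (4 - 4 * s) / N) - 1) + B * (Real.exp (θ * (4 + 4 * s) / N) - 1)
      ≤ θ * ((12 * a₁ + 4 * a₂ + 4 * a₁ * k ^ 2) - (2 * a₂ / k) * (s ^ 2 / N)) := by
  have hN0 : 0 < N := by linarith
  have hexp : ∀ t : ℝ, |t| ≤ N → Real.exp (θ * (4 + 4 * t) / N) - 1 ≤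
      θ * (4 + 4 * t) / N + (θ * (4 + 4 * t) / N) ^ 2 := by
    intro t ht
    have hz : |θ * (4 + 4 * t) / N| ≤ 1 := by
      rw [abs_div, abs_of_pos hN0, div_le_one hN0, abs_mul, abs_of_pos hθ]
      have : |4 + 4 * t| ≤ 8 * N := by
        rw [abs_le] at *; constructor <;> linarith [ht.1, ht.2]
      calc θ * |4 + 4 * t| ≤ (1 / 8) * (8 * N) := by gcongr
        _ = N := by ring
    have := (abs_le.1 (Real.abs_exp_sub_one_sub_id_le hz)).2
    linarith
  have e1 := hexp (-s) (by rwa [abs_neg])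
  have e2 := hexp s hs
  have e1' : θ * (4 + 4 * -s) / N = θ * (4 - 4 * s) / N := by ring
  rw [e1'] at e1
  have m1 := mul_le_mul_of_nonneg_left e1 hA
  have m2 := mul_le_mul_of_nonneg_left e2 hB
  have lin : A * (θ * (4 - 4 * s) / N) + B * (θ * (4 + 4 * s) / N) =
      θ * (4 * ((A + B) / N) - 4 * (s * (A - B) / N)) := by ring
  have b1 : (A + B) / N ≤ 2 * a₁ := by
    rw [div_le_iff₀ hN0]; linarith
  have b2 : a₂ / k * (s ^ 2 / N) - a₂ - a₁ * k ^ 2 ≤ s * (A - B) / N := by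
    have h1 : a₂ / k * s ^ 2 - a₂ * N - a₁ * k ^ 2 * N ≤ s * (A - B) := by
      have h2 := mul_le_mul_of_nonneg_left hs ha₂.le
      have h3 := mul_le_mul_of_nonneg_left hN (by positivity : 0 ≤ a₁ * k ^ 2)
      linarith
    rw [le_div_iff₀ hN0]
    have : (a₂ / k * (s ^ 2 / N) - a₂ - a₁ * k ^ 2) * N =
      a₂ / k * s ^ 2 - a₂ * N - a₁ * k ^ 2 * N := by field_simp
    linarith
  have q1 : A * (θ * (4 - 4 * s) / N) ^ 2 + B * (θ * (4 + 4 * s) / N) ^ 2 ≤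
      θ * (32 * θ * a₁ * (1 / N) + 32 * θ * a₁ * (s ^ 2 / N)) := by
    calc A * (θ * (4 - 4 * s) / N) ^ 2 + B * (θ * (4 + 4 * s) / N) ^ 2
        ≤ (a₁ * N) * (θ * (4 - 4 * s) / N) ^ 2 + (a₁ * N) * (θ * (4 + 4 * s) / N) ^ 2 := by gcongr
      _ = _ := by field_simp; ring
  have q2 : 32 * θ * a₁ * (1 / N) ≤ 4 * a₁ := by
    have : 1 / N ≤ 1 := by rw [div_le_one hN0]; exact hN
    have h2 : 32 * θ * a₁ ≤ 4 * a₁ := by nlinarith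
    calc 32 * θ * a₁ * (1 / N) ≤ 32 * θ * a₁ * 1 := by gcongr
      _ ≤ _ := by linarith
  have q3 : 32 * θ * a₁ * (s ^ 2 / N) ≤ 2 * (a₂ / k) * (s ^ 2 / N) := by
    have : 32 * θ * a₁ ≤ 2 * (a₂ / k) := by
      have : θ * (16 * a₁) ≤ a₂ / k := by rw [le_div_iff₀ hk]; linarith
      linarith
    gcongr
  have fin : 4 * ((A + B) / N) - 4 * (s * (A - B) / N) +
      (32 * θ * a₁ * (1 / N) + 32 * θ * a₁ * (s ^ 2 / N)) ≤
      (12 * a₁ + 4 * a₂ + 4 * a₁ * k ^ 2) - (2 * a₂ / k) * (s ^ 2 / N) := by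
    have : 2 * a₂ / k = 2 * (a₂ / k) := by ring
    rw [this]
    linarith
  have fin' := mul_le_mul_of_nonneg_left fin hθ.le
  linarith

/-- the exponential moment bound for a pair of sites -/
lemma zr_expmom {c : ℕ → ℝ} {a₁ a₂ : ℝ} {k₀ : ℕ}
    (hc0 : c 0 = 0) (hcpos : ∀ n : ℕ, 0 < n → 0 < c n)
    (hLG : ∀ k : ℕ, |c (k + 1) - c k| ≤ a₁) (ha₁ : 0 < a₁)
    (hk₀ : 0 < k₀) (ha₂ : 0 < a₂)
    (hM : ∀ j k : ℕ, j + k₀ ≤ k → a₂ ≤ c k - c j) {θ : ℝ}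
    (hθ : 0 < θ) (hθ1 : θ ≤ 1 / 8) (hθ2 : θ * (16 * a₁ * k₀) ≤ a₂) :
    ∃ K : ℝ, 1 ≤ K ∧ ∀ (Λ : Finset ℤ) (N : ℕ), 1 ≤ N → ∀ x ∈ Λ, ∀ y ∈ Λ,
      ∑ η ∈ Λ.piAntidiag N, (∏ z ∈ Λ, (cfact c (η z))⁻¹) *
        Real.exp (θ * (((η x : ℝ) - η y) ^ 2 / N)) ≤
      K * ∑ η ∈ Λ.piAntidiag N, (∏ z ∈ Λ, (cfact c (η z))⁻¹) := by
  set D : ℝ := 12 * a₁ + 4 * a₂ + 4 * a₁ * (k₀ : ℝ) ^ 2 with hD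
  set κ : ℝ := 2 * a₂ / k₀ with hκ
  have hk : (0 : ℝ) < k₀ := by exact_mod_cast hk₀
  have hD0 : 0 < D := by positivity
  have hκ0 : 0 < κ := by positivity
  have hK1 : 1 ≤ Real.exp (θ * (2 * D / κ)) := Real.one_le_exp (by positivity)
  refine ⟨2 * Real.exp (θ * (2 * D / κ)), by linarith, ?_⟩
  intro Λ N hN x hx y hy
  have hW : ∀ η : ℤ → ℕ, 0 < ∏ z ∈ Λ, (cfact c (η z))⁻¹ := fun η =>
    Finset.prod_pos fun z _ => inv_pos.2 (zr_cfact_pos hcpos _)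
  by_cases hxy : x = y
  · subst hxy
    simp only [sub_self]
    rw [Finset.mul_sum]
    apply Finset.sum_le_sum
    intro η _
    have h1 := hW η
    have h2 : Real.exp (θ * ((0 : ℝ) ^ 2 / N)) = 1 := by simp
    rw [h2]
    nlinarith
  set F : (ℤ → ℕ) → ℝ := fun η => Real.exp (θ * (((η x : ℝ) - η y) ^ 2 / N)) with hF
  have r1 := zr_rev hc0 hcpos N hx hy hxy F
  have r2 := zr_rev hc0 hcpos N hy hx (Ne.symm hxy) F
  have hN1 : (1 : ℝ) ≤ N := by exact_mod_cast hN
  have hNpos : (0 : ℝ) < N := by linarith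
  have hc_nonneg : ∀ n, 0 ≤ c n := fun n => by
    rcases Nat.eq_zero_or_pos n with h | h
    · rw [h, hc0]
    · exact (hcpos n h).le
  have hc_le : ∀ n, c n ≤ a₁ * n := fun n => by
    have := zr_lip hLG 0 n
    rw [zero_add, hc0, sub_zero] at this
    exact (le_abs_self _).trans this
  have hpt : ∀ η ∈ Λ.piAntidiag N,
      c (η x) * (F (move η x y) - F η) + c (η y) * (F (move η y x) - F η) ≤
      F η * (θ * (D - κ * (((η x : ℝ) - η y) ^ 2 / N))) := by
    intro η hη
    rw [Finset.mem_piAntidiag] at hη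
    have hle : ∀ z ∈ Λ, (η z : ℝ) ≤ N := fun z hz => by
      have : η z ≤ N := by
        rw [← hη.1]; exact Finset.single_le_sum (f := η) (fun _ _ => Nat.zero_le _) hz
      exact_mod_cast this
    have key := zr_point (θ := θ) (N := N) (A := c (η x)) (B := c (η y)) (s := (η x : ℝ) - η y)
      (a₁ := a₁) (a₂ := a₂) (k := k₀) hN1 (hc_nonneg _) (hc_nonneg _)
      ((hc_le _).trans (by have := hle x hx; gcongr))
      ((hc_le _).trans (by have := hle y hy; gcongr))
      (by
        have h1 := hle x hx
        have h2 := hle y hy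
        have h3 : (0 : ℝ) ≤ η x := Nat.cast_nonneg _
        have h4 : (0 : ℝ) ≤ η y := Nat.cast_nonneg _
        rw [abs_le]; constructor <;> linarith)
      ha₁ ha₂ hk hθ hθ1 hθ2 (zr_drift hLG ha₁ hk₀ ha₂ hM (η x) (η y))
    have hFpos : 0 < F η := Real.exp_pos _
    have i1 : c (η x) * F (move η x y) = c (η x) *
        (F η * Real.exp (θ * (4 - 4 * ((η x : ℝ) - η y)) / N)) := by
      rcases Nat.eq_zero_or_pos (η x) with h | h
      · rw [h, hc0]; simp
      · congr 1
        simp only [hF]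
        rw [← Real.exp_add, zr_move_x, zr_move_y _ hxy]
        congr 1
        rw [Nat.cast_sub h]
        push_cast
        field_simp
        ring
    have i2 : c (η y) * F (move η y x) = c (η y) *
        (F η * Real.exp (θ * (4 + 4 * ((η x : ℝ) - η y)) / N)) := by
      rcases Nat.eq_zero_or_pos (η y) with h | h
      · rw [h, hc0]; simp
      · congr 1
        simp only [hF]
        rw [← Real.exp_add, zr_move_x, zr_move_y _ (Ne.symm hxy)]
        congr 1
        rw [Nat.cast_sub h]
        push_cast
        field_simp
        ring
    have key' := mul_le_mul_of_nonneg_left key hFpos.le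
    rw [mul_sub, mul_sub, i1, i2]
    refine le_trans (le_of_eq ?_) key'
    ring
  have hzero : ∑ η ∈ Λ.piAntidiag N, (∏ z ∈ Λ, (cfact c (η z))⁻¹) *
      (c (η x) * (F (move η x y) - F η) + c (η y) * (F (move η y x) - F η)) = 0 := by
    have : ∀ η, (∏ z ∈ Λ, (cfact c (η z))⁻¹) *
      (c (η x) * (F (move η x y) - F η) + c (η y) * (F (move η y x) - F η)) =
      ((∏ z ∈ Λ, (cfact c (η z))⁻¹) * c (η x) * F (move η x y)
        - (∏ z ∈ Λ, (cfact c (η z))⁻¹) * c (η x) * F η) +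
      ((∏ z ∈ Λ, (cfact c (η z))⁻¹) * c (η y) * F (move η y x)
        - (∏ z ∈ Λ, (cfact c (η z))⁻¹) * c (η y) * F η) := fun η => by ring
    simp only [this, Finset.sum_add_distrib, Finset.sum_sub_distrib]
    rw [r1, r2]; ring
  have hmain : 0 ≤ ∑ η ∈ Λ.piAntidiag N, (∏ z ∈ Λ, (cfact c (η z))⁻¹) *
      (F η * (D - κ * (((η x : ℝ) - η y) ^ 2 / N))) := by
    have h1 : 0 ≤ ∑ η ∈ Λ.piAntidiag N, (∏ z ∈ Λ, (cfact c (η z))⁻¹) *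
        (F η * (θ * (D - κ * (((η x : ℝ) - η y) ^ 2 / N)))) := by
      rw [← hzero]
      exact Finset.sum_le_sum fun η hη => mul_le_mul_of_nonneg_left (hpt η hη) (hW η).le
    have h2 : ∑ η ∈ Λ.piAntidiag N, (∏ z ∈ Λ, (cfact c (η z))⁻¹) *
        (F η * (θ * (D - κ * (((η x : ℝ) - η y) ^ 2 / N)))) =
        θ * ∑ η ∈ Λ.piAntidiag N, (∏ z ∈ Λ, (cfact c (η z))⁻¹) *
        (F η * (D - κ * (((η x : ℝ) - η y) ^ 2 / N))) := by
      rw [Finset.mul_sum]; exact Finset.sum_congr rfl fun η _ => by ring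
    rw [h2] at h1
    exact nonneg_of_mul_nonneg_right h1 hθ
  have hpt2 : ∀ η : ℤ → ℕ, F η + (1 / D) * (F η * (D - κ * (((η x : ℝ) - η y) ^ 2 / N))) ≤
      2 * Real.exp (θ * (2 * D / κ)) := by
    intro η
    set S : ℝ := ((η x : ℝ) - η y) ^ 2 / N with hS
    have hS0 : 0 ≤ S := by positivity
    have hFpos : 0 < F η := Real.exp_pos _
    have e : F η + (1 / D) * (F η * (D - κ * S)) = F η * (2 - κ * S / D) := by field_simp; ring
    rw [e]
    rcases le_total (2 * D / κ) S with h | h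
    · have : 2 ≤ κ * S / D := by
        rw [le_div_iff₀ hD0]; rw [div_le_iff₀ hκ0] at h; linarith
      have := Real.exp_pos (θ * (2 * D / κ))
      nlinarith
    · have h1 : F η ≤ Real.exp (θ * (2 * D / κ)) := by
        simp only [hF]
        apply Real.exp_le_exp.2
        gcongr
      have h2 : 0 ≤ κ * S / D := by positivity
      nlinarith
  have hfin := Finset.sum_le_sum (s := Λ.piAntidiag N)
    fun η _ => mul_le_mul_of_nonneg_left (hpt2 η) (hW η).le
  have e1 : ∑ η ∈ Λ.piAntidiag N, (∏ z ∈ Λ, (cfact c (η z))⁻¹) *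
      (F η + (1 / D) * (F η * (D - κ * (((η x : ℝ) - η y) ^ 2 / N)))) =
      ∑ η ∈ Λ.piAntidiag N, (∏ z ∈ Λ, (cfact c (η z))⁻¹) * F η +
      (1 / D) * ∑ η ∈ Λ.piAntidiag N, (∏ z ∈ Λ, (cfact c (η z))⁻¹) *
      (F η * (D - κ * (((η x : ℝ) - η y) ^ 2 / N))) := by
    rw [Finset.mul_sum, ← Finset.sum_add_distrib]
    exact Finset.sum_congr rfl fun η _ => by ring
  rw [e1, ← Finset.sum_mul] at hfin
  have h3 : 0 ≤ (1 / D) * ∑ η ∈ Λ.piAntidiag N, (∏ z ∈ Λ, (cfact c (η z))⁻¹) *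
      (F η * (D - κ * (((η x : ℝ) - η y) ^ 2 / N))) := mul_nonneg (by positivity) hmain
  linarith

lemma zr_dev {c : ℕ → ℝ} {a₁ : ℝ} (hLG : ∀ k : ℕ, |c (k + 1) - c k| ≤ a₁) (ha₁ : 0 < a₁)
    {Λ : Finset ℤ} (hΛ : Λ.Nonempty) {N : ℕ} {η : ℤ → ℕ} (hη : ∑ x ∈ Λ, η x = N) :
    (∑ x ∈ Λ, c (η x) - Λ.card * c (N / Λ.card)) ^ 2 ≤
      a₁ ^ 2 * (Λ.card : ℝ) ^ 2 * ∑ x ∈ Λ, ∑ y ∈ Λ, ((η x : ℝ) - η y) ^ 2 := by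
  set q := N / Λ.card with hq
  set T : ℝ := ∑ x ∈ Λ, ∑ y ∈ Λ, ((η x : ℝ) - η y) ^ 2 with hT
  have hcard : 0 < Λ.card := hΛ.card_pos
  have hlow : ∃ y ∈ Λ, η y ≤ q := by
    by_contra hcon
    push Not at hcon
    have h1 : Λ.card • (q + 1) ≤ ∑ x ∈ Λ, η x := Finset.card_nsmul_le_sum _ _ _ hcon
    rw [hη, smul_eq_mul] at h1
    have := Nat.lt_mul_div_succ N hcard
    rw [← hq] at this
    omega
  have hup : ∃ y ∈ Λ, q ≤ η y := by
    by_contra hcon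
    push Not at hcon
    have h1 : ∑ x ∈ Λ, η x < ∑ x ∈ Λ, q := Finset.sum_lt_sum_of_nonempty hΛ hcon
    rw [hη, Finset.sum_const, smul_eq_mul] at h1
    have := Nat.mul_div_le N Λ.card
    rw [← hq] at this
    omega
  have hpair : ∀ x ∈ Λ, ∀ y ∈ Λ, ((η x : ℝ) - η y) ^ 2 ≤ T := by
    intro x hx y hy
    calc ((η x : ℝ) - η y) ^ 2 ≤ ∑ y ∈ Λ, ((η x : ℝ) - η y) ^ 2 :=
          Finset.single_le_sum (f := fun y => ((η x : ℝ) - η y) ^ 2) (fun _ _ => sq_nonneg _) hy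
      _ ≤ T := Finset.single_le_sum (f := fun x => ∑ y ∈ Λ, ((η x : ℝ) - η y) ^ 2)
          (fun _ _ => Finset.sum_nonneg fun _ _ => sq_nonneg _) hx
  have hone : ∀ x ∈ Λ, (c (η x) - c q) ^ 2 ≤ a₁ ^ 2 * T := by
    intro x hx
    have h1 : ((η x : ℝ) - q) ^ 2 ≤ T := by
      rcases le_total (η x) q with h | h
      · obtain ⟨y, hy, hyq⟩ := hup
        refine le_trans ?_ (hpair x hx y hy)
        have h' : (η x : ℝ) ≤ q := by exact_mod_cast h
        have h'' : (q : ℝ) ≤ η y := by exact_mod_cast hyq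
        nlinarith
      · obtain ⟨y, hy, hyq⟩ := hlow
        refine le_trans ?_ (hpair x hx y hy)
        have h' : (q : ℝ) ≤ η x := by exact_mod_cast h
        have h'' : (η y : ℝ) ≤ q := by exact_mod_cast hyq
        nlinarith
    have h2 := zr_lip' hLG (η x) q
    calc (c (η x) - c q) ^ 2 = |c (η x) - c q| ^ 2 := (sq_abs _).symm
      _ ≤ (a₁ * |(η x : ℝ) - q|) ^ 2 := by gcongr
      _ = a₁ ^ 2 * ((η x : ℝ) - q) ^ 2 := by rw [mul_pow, sq_abs]
      _ ≤ _ := by gcongr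
  have e : ∑ x ∈ Λ, c (η x) - Λ.card * c q = ∑ x ∈ Λ, (c (η x) - c q) := by
    rw [Finset.sum_sub_distrib, Finset.sum_const, nsmul_eq_mul]
  rw [e]
  calc (∑ x ∈ Λ, (c (η x) - c q)) ^ 2 ≤ Λ.card * ∑ x ∈ Λ, (c (η x) - c q) ^ 2 :=
        sq_sum_le_card_mul_sum_sq
    _ ≤ Λ.card * ∑ x ∈ Λ, a₁ ^ 2 * T := by gcongr with x hx; exact hone x hx
    _ = _ := by rw [Finset.sum_const, nsmul_eq_mul]; ring

open Classical in
lemma zr_nuW_eq (c : ℕ → ℝ) (Λ : Finset ℤ) (N : ℕ) (η : ℤ → ℕ) :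
    nuW c Λ N η = if η ∈ Λ.piAntidiag N then ∏ x ∈ Λ, (cfact c (η x))⁻¹ else 0 := by
  unfold nuW
  rw [Set.indicator_apply]
  have : η ∈ {η : ℤ → ℕ | (∀ x, x ∉ Λ → η x = 0) ∧ (∑ x ∈ Λ, η x) = N} ↔
      η ∈ Λ.piAntidiag N := by
    rw [Finset.mem_piAntidiag, Set.mem_setOf_eq, and_comm]
    refine and_congr Iff.rfl (forall_congr' fun x => ?_)
    exact not_imp_comm
  by_cases h : η ∈ Λ.piAntidiag N
  · rw [if_pos h, if_pos (this.2 h)]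
  · rw [if_neg h, if_neg (fun h' => h (this.1 h'))]

lemma zr_wE (c : ℕ → ℝ) (Λ : Finset ℤ) (N : ℕ) (h : (ℤ → ℕ) → ℝ) :
    wE (nuW c Λ N) h = ∑ η ∈ Λ.piAntidiag N, ((∏ x ∈ Λ, (cfact c (η x))⁻¹) /
      (∑ η ∈ Λ.piAntidiag N, ∏ x ∈ Λ, (cfact c (η x))⁻¹)) * h η := by
  unfold wE
  rw [tsum_eq_sum (s := Λ.piAntidiag N), tsum_eq_sum (s := Λ.piAntidiag N)]
  · have e1 : ∑ η ∈ Λ.piAntidiag N, nuW c Λ N η =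
        ∑ η ∈ Λ.piAntidiag N, ∏ x ∈ Λ, (cfact c (η x))⁻¹ :=
      Finset.sum_congr rfl fun η hη => by rw [zr_nuW_eq, if_pos hη]
    rw [e1, Finset.sum_div]
    refine Finset.sum_congr rfl fun η hη => ?_
    rw [zr_nuW_eq, if_pos hη]; ring
  · intro η hη; rw [zr_nuW_eq, if_neg hη]
  · intro η hη; rw [zr_nuW_eq, if_neg hη, zero_mul]

/-- passing from normalized to general densities -/
lemma zr_homog {ι : Type*} (P : Finset ι) (μ f g : ι → ℝ) (m₀ B K θ' : ℝ)
    (T : Finset (ℤ × ℤ)) (S : ℤ × ℤ → ι → ℝ) (hθ' : 0 < θ') (hB : 0 ≤ B) (hK : 0 ≤ K)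
    (hμ : ∀ i ∈ P, 0 ≤ μ i) (hμ1 : ∑ i ∈ P, μ i = 1) (hf : ∀ i, 0 ≤ f i)
    (hg : ∀ i ∈ P, (g i - m₀) ^ 2 ≤ B * ∑ p ∈ T, S p i)
    (hS : ∀ p ∈ T, ∑ i ∈ P, μ i * Real.exp (θ' * S p i) ≤ K) :
    (∑ i ∈ P, μ i * (f i * g i) - (∑ i ∈ P, μ i * f i) * ∑ i ∈ P, μ i * g i) ^ 2 ≤
      2 * (B / θ' * T.card) * (1 + 2 * K) * (∑ i ∈ P, μ i * f i) *
      (∑ i ∈ P, μ i * (f i * Real.log (f i)) -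
        (∑ i ∈ P, μ i * f i) * Real.log (∑ i ∈ P, μ i * f i)) := by
  set m := ∑ i ∈ P, μ i * f i with hm
  have hm0 : 0 ≤ m := Finset.sum_nonneg fun i hi => mul_nonneg (hμ i hi) (hf i)
  rcases hm0.eq_or_lt with h0 | hmpos
  · have hz : ∀ i ∈ P, μ i * f i = 0 := by
      have := (Finset.sum_eq_zero_iff_of_nonneg
        (fun i hi => mul_nonneg (hμ i hi) (hf i))).1 (hm ▸ h0.symm : ∑ i ∈ P, μ i * f i = 0)
      exact this
    have e1 : ∑ i ∈ P, μ i * (f i * g i) = 0 :=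
      Finset.sum_eq_zero fun i hi => by rw [← mul_assoc, hz i hi, zero_mul]
    rw [e1, ← h0]; simp
  set F : ι → ℝ := fun i => f i / m with hF
  have hF0 : ∀ i ∈ P, 0 ≤ F i := fun i _ => div_nonneg (hf i) hm0
  have hF1 : ∑ i ∈ P, μ i * F i = 1 := by
    have : ∀ i, μ i * F i = μ i * f i / m := fun i => by simp only [hF]; ring
    simp only [this, ← Finset.sum_div]
    rw [← hm]; exact div_self hmpos.ne'
  set E := ∑ i ∈ P, μ i * (F i * Real.log (F i)) with hE
  have hyoung : ∀ p ∈ T, ∑ i ∈ P, μ i * (F i * (θ' * S p i)) ≤ E + K := by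
    intro p hp
    have h1 : ∑ i ∈ P, μ i * (F i * (θ' * S p i)) ≤
        ∑ i ∈ P, μ i * (F i * Real.log (F i) - F i + Real.exp (θ' * S p i)) :=
      Finset.sum_le_sum fun i hi => mul_le_mul_of_nonneg_left (zr_young (hF0 i hi) _) (hμ i hi)
    simp only [mul_add, mul_sub, Finset.sum_add_distrib, Finset.sum_sub_distrib] at h1
    rw [hF1] at h1
    linarith [hS p hp]
  have hplain : ∀ p ∈ T, ∑ i ∈ P, μ i * (θ' * S p i) ≤ K := by
    intro p hp
    refine le_trans (Finset.sum_le_sum fun i hi => mul_le_mul_of_nonneg_left ?_ (hμ i hi)) (hS p hp)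
    linarith [Real.add_one_le_exp (θ' * S p i)]
  have h1 : ∑ i ∈ P, μ i * (F i * (g i - m₀) ^ 2) ≤ (B / θ' * T.card) * (E + K) := by
    calc ∑ i ∈ P, μ i * (F i * (g i - m₀) ^ 2)
        ≤ ∑ i ∈ P, μ i * (F i * (B * ∑ p ∈ T, S p i)) :=
          Finset.sum_le_sum fun i hi => mul_le_mul_of_nonneg_left
            (mul_le_mul_of_nonneg_left (hg i hi) (hF0 i hi)) (hμ i hi)
      _ = ∑ i ∈ P, ∑ p ∈ T, (B / θ') * (μ i * (F i * (θ' * S p i))) := by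
          refine Finset.sum_congr rfl fun i _ => ?_
          rw [Finset.mul_sum, Finset.mul_sum, Finset.mul_sum]
          refine Finset.sum_congr rfl fun p _ => ?_
          field_simp
      _ = ∑ p ∈ T, (B / θ') * ∑ i ∈ P, μ i * (F i * (θ' * S p i)) := by
          rw [Finset.sum_comm]
          exact Finset.sum_congr rfl fun p _ => (Finset.mul_sum _ _ _).symm
      _ ≤ ∑ p ∈ T, (B / θ') * (E + K) :=
          Finset.sum_le_sum fun p hp => mul_le_mul_of_nonneg_left (hyoung p hp) (by positivity)
      _ = _ := by rw [Finset.sum_const, nsmul_eq_mul]; ring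
  have h2 : ∑ i ∈ P, μ i * (g i - m₀) ^ 2 ≤ (B / θ' * T.card) * K := by
    calc ∑ i ∈ P, μ i * (g i - m₀) ^ 2
        ≤ ∑ i ∈ P, μ i * (B * ∑ p ∈ T, S p i) :=
          Finset.sum_le_sum fun i hi => mul_le_mul_of_nonneg_left (hg i hi) (hμ i hi)
      _ = ∑ i ∈ P, ∑ p ∈ T, (B / θ') * (μ i * (θ' * S p i)) := by
          refine Finset.sum_congr rfl fun i _ => ?_
          rw [Finset.mul_sum, Finset.mul_sum]
          refine Finset.sum_congr rfl fun p _ => ?_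
          field_simp
      _ = ∑ p ∈ T, (B / θ') * ∑ i ∈ P, μ i * (θ' * S p i) := by
          rw [Finset.sum_comm]
          exact Finset.sum_congr rfl fun p _ => (Finset.mul_sum _ _ _).symm
      _ ≤ ∑ p ∈ T, (B / θ') * K :=
          Finset.sum_le_sum fun p hp => mul_le_mul_of_nonneg_left (hplain p hp) (by positivity)
      _ = _ := by rw [Finset.sum_const, nsmul_eq_mul]; ring
  have hab := zr_abstract P μ F (fun i => g i - m₀) (B / θ' * T.card) K (by positivity) hK
    hμ hμ1 hF0 hF1 h1 h2
  rw [← hE] at hab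
  have hcov : ∑ i ∈ P, μ i * (f i * g i) - m * ∑ i ∈ P, μ i * g i =
      m * ∑ i ∈ P, μ i * ((F i - 1) * (g i - m₀)) := by
    have : ∀ i, μ i * ((F i - 1) * (g i - m₀)) =
      μ i * (f i * g i) / m - μ i * g i - μ i * F i * m₀ + μ i * m₀ := fun i => by
        simp only [hF]; ring
    simp only [this, Finset.sum_add_distrib, Finset.sum_sub_distrib, ← Finset.sum_div,
      ← Finset.sum_mul]
    rw [hF1, hμ1]
    field_simp
    ring
  have hent : ∑ i ∈ P, μ i * (f i * Real.log (f i)) - m * Real.log m = m * E := by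
    have : ∀ i, μ i * (F i * Real.log (F i)) =
        μ i * (f i * Real.log (f i)) / m - μ i * f i * (Real.log m / m) := fun i => by
      simp only [hF]
      rcases (hf i).eq_or_lt with h | h
      · rw [← h]; simp
      · rw [Real.log_div h.ne' hmpos.ne']; ring
    rw [hE]
    simp only [this, Finset.sum_sub_distrib, ← Finset.sum_div, ← Finset.sum_mul]
    rw [← hm]
    field_simp
  rw [hcov, hent, mul_pow]
  have := mul_le_mul_of_nonneg_left hab (sq_nonneg m)
  refine this.trans (le_of_eq ?_)
  ring

/-- Proposition 3.6, inequality (3.23). -/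
theorem statement7
    (c : ℕ → ℝ) (a₁ a₂ : ℝ) (k₀ : ℕ)
    (hc0 : c 0 = 0) (hcpos : ∀ n : ℕ, 0 < n → 0 < c n)
    (hLG : ∀ k : ℕ, |c (k + 1) - c k| ≤ a₁)
    (hk₀ : 0 < k₀) (ha₂ : 0 < a₂)
    (hM : ∀ j k : ℕ, j + k₀ ≤ k → a₂ ≤ c k - c j)
    (L : ℕ) (hL : 1 ≤ L) :
    ∃ C : ℝ, 0 < C ∧ ∀ (a : ℤ) (N : ℕ), 1 ≤ N →
      ∀ f : (ℤ → ℕ) → ℝ, (∀ η, 0 ≤ f η) →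
        (wCov (nuW c (Finset.Ico a (a + (L : ℤ))) N) f
            (fun η => ∑ x ∈ Finset.Ico a (a + (L : ℤ)), c (η x))) ^ 2
          ≤ C * (N : ℝ) * wE (nuW c (Finset.Ico a (a + (L : ℤ))) N) f *
              wEnt (nuW c (Finset.Ico a (a + (L : ℤ))) N) f := by
  have ha₁ : 0 < a₁ := by
    have h1 := hLG 0
    rw [hc0, sub_zero] at h1
    exact lt_of_lt_of_le (hcpos 1 one_pos) ((le_abs_self _).trans h1)
  have hk : (0 : ℝ) < k₀ := by exact_mod_cast hk₀
  obtain ⟨θ, hθ, hθ1, hθ2⟩ : ∃ θ : ℝ, 0 < θ ∧ θ ≤ 1 / 8 ∧ θ * (16 * a₁ * k₀) ≤ a₂ := by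
    refine ⟨min (1 / 8) (a₂ / (16 * a₁ * k₀)), by positivity, min_le_left _ _, ?_⟩
    rw [← le_div_iff₀ (by positivity)]
    exact min_le_right _ _
  obtain ⟨K, hK, hexp⟩ := zr_expmom hc0 hcpos hLG ha₁ hk₀ ha₂ hM hθ hθ1 hθ2
  have hLpos : (0 : ℝ) < L := by exact_mod_cast hL
  have hKpos : 0 < K := by linarith
  refine ⟨2 * (a₁ ^ 2 * (L : ℝ) ^ 2 / θ * (L : ℝ) ^ 2) * (1 + 2 * K), by positivity, ?_⟩
  intro a N hN f hf
  set Λ := Finset.Ico a (a + (L : ℤ)) with hΛ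
  have hcard : Λ.card = L := by simp [hΛ]
  have hne : Λ.Nonempty := by rw [← Finset.card_pos, hcard]; exact hL
  have hNpos : (0 : ℝ) < N := by exact_mod_cast hN
  have hW : ∀ η : ℤ → ℕ, 0 < ∏ z ∈ Λ, (cfact c (η z))⁻¹ := fun η =>
    Finset.prod_pos fun z _ => inv_pos.2 (zr_cfact_pos hcpos _)
  have hPne : (Λ.piAntidiag N).Nonempty := by
    obtain ⟨x, hx⟩ := hne
    refine ⟨fun z => if z = x then N else 0, ?_⟩
    rw [Finset.mem_piAntidiag]
    constructor
    · simp [hx]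
    · intro i hi
      by_cases h : i = x
      · rwa [h]
      · simp [h] at hi
  have hZ : 0 < ∑ η ∈ Λ.piAntidiag N, ∏ x ∈ Λ, (cfact c (η x))⁻¹ :=
    Finset.sum_pos (fun η _ => hW η) hPne
  unfold wCov wEnt
  simp only [zr_wE]
  set Z := ∑ η ∈ Λ.piAntidiag N, ∏ x ∈ Λ, (cfact c (η x))⁻¹ with hZdef
  have hmain := zr_homog (Λ.piAntidiag N) (fun η => (∏ x ∈ Λ, (cfact c (η x))⁻¹) / Z) f
    (fun η => ∑ x ∈ Λ, c (η x)) (Λ.card * c (N / Λ.card)) (a₁ ^ 2 * (L : ℝ) ^ 2) K (θ / N)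
    (Λ ×ˢ Λ) (fun p η => ((η p.1 : ℝ) - η p.2) ^ 2) (by positivity) (by positivity) hKpos.le
    (fun η _ => div_nonneg (hW η).le hZ.le)
    (by rw [← Finset.sum_div]; exact div_self hZ.ne') hf
    (by
      intro η hη
      rw [Finset.mem_piAntidiag] at hη
      rw [Finset.sum_product, ← hcard]
      exact zr_dev hLG ha₁ hne hη.1)
    (by
      intro p hp
      rw [Finset.mem_product] at hp
      have h1 := hexp Λ N hN p.1 hp.1 p.2 hp.2
      rw [← hZdef, ← div_le_iff₀ hZ, Finset.sum_div] at h1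
      refine le_trans (le_of_eq (Finset.sum_congr rfl fun η _ => ?_)) h1
      have : θ / N * ((η p.1 : ℝ) - η p.2) ^ 2 = θ * (((η p.1 : ℝ) - η p.2) ^ 2 / N) := by ring
      rw [this]; ring)
  refine hmain.trans (le_of_eq ?_)
  congr 2
  rw [Finset.card_product, hcard]
  push_cast
  field_simp
end
end

section
/- For every L there exists a constant C_L (depending only on L) such that for every segment Λ ⊂ ℤ with |Λ| = L, every N ≥ 1 and every f ≥ 0, ν_Λ^N[ f , Σ_{x∈Λ} h(η_x) ]² ≤ C_L N⁻¹ ν_Λ^N[f] ( ν_Λ^N[f] + Ent_{ν_Λ^N}(f) ), where h(n) := (n+1)/c(n+1). -/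
open scoped BigOperators

noncomputable section

open Finset in
lemma s8_young (f φ u : ℝ) (hf : 0 ≤ f) (hφ : 0 < φ) :
    f * u ≤ f * Real.log f - f * Real.log φ - f + φ * Real.exp u := by
  rcases hf.eq_or_lt with h | h
  · subst h; simp; positivity
  · have h1 := Real.add_one_le_exp (u - Real.log f + Real.log φ)
    have h2 : f * Real.exp (u - Real.log f + Real.log φ) = φ * Real.exp u := by
      rw [Real.exp_add, Real.exp_sub, Real.exp_log h, Real.exp_log hφ]
      field_simp
    nlinarith [mul_le_mul_of_nonneg_left h1 hf]

lemma s8_entropy {Ω : Type*} (S : Finset Ω) (p f u : Ω → ℝ) (hp : ∀ η ∈ S, 0 ≤ p η)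
    (hf : ∀ η, 0 ≤ f η) (φ : ℝ) (hφ : 0 < φ) (hfφ : ∑ η ∈ S, p η * f η = φ)
    (hu : ∑ η ∈ S, p η * Real.exp (u η) ≤ 1) :
    ∑ η ∈ S, p η * (f η * u η) ≤ ∑ η ∈ S, p η * (f η * Real.log (f η)) - φ * Real.log φ := by
  have h1 : ∑ η ∈ S, p η * (f η * u η) ≤ ∑ η ∈ S, (p η * (f η * Real.log (f η))
      - (p η * f η) * Real.log φ - p η * f η + φ * (p η * Real.exp (u η))) := by
    apply Finset.sum_le_sum
    intro η hη
    have := mul_le_mul_of_nonneg_left (s8_young (f η) φ (u η) (hf η) hφ) (hp η hη)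
    nlinarith [this]
  rw [Finset.sum_add_distrib, Finset.sum_sub_distrib, Finset.sum_sub_distrib, ← Finset.sum_mul,
    ← Finset.mul_sum, hfφ] at h1
  nlinarith

lemma s8_final {Ω : Type*} (S : Finset Ω) (p f F g : Ω → ℝ) (m B N : ℝ)
    (hp : ∀ η ∈ S, 0 ≤ p η) (hp1 : ∑ η ∈ S, p η = 1) (hf : ∀ η, 0 ≤ f η)
    (hB : 0 ≤ B) (hN : 0 < N) (hFg : ∀ η ∈ S, |F η - m| ≤ g η)
    (hexp : ∀ t : ℝ, 0 < t →
      ∑ η ∈ S, p η * Real.exp (t * g η) ≤ Real.exp (B * (1 + t ^ 2 / N))) :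
    (∑ η ∈ S, p η * (f η * F η) - (∑ η ∈ S, p η * f η) * (∑ η ∈ S, p η * F η)) ^ 2
      ≤ (4 * B + 1) ^ 2 * N⁻¹ * (∑ η ∈ S, p η * f η) * ((∑ η ∈ S, p η * f η) +
        (∑ η ∈ S, p η * (f η * Real.log (f η))
          - (∑ η ∈ S, p η * f η) * Real.log (∑ η ∈ S, p η * f η))) := by
  have key : ∀ (f : Ω → ℝ), (∀ η, 0 ≤ f η) → ∀ φ, 0 < φ → ∑ η ∈ S, p η * f η = φ →
      ∀ t : ℝ, 0 < t → t * ∑ η ∈ S, p η * (f η * g η) ≤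
      (∑ η ∈ S, p η * (f η * Real.log (f η)) - φ * Real.log φ) + B * (1 + t ^ 2 / N) * φ := by
    intro f hf φ hφ hfφ t ht
    have := s8_entropy S p f (fun η => t * g η - B * (1 + t ^ 2 / N)) hp hf φ hφ hfφ (by
      simp only [Real.exp_sub]
      calc ∑ η ∈ S, p η * (Real.exp (t * g η) / Real.exp (B * (1 + t ^ 2 / N)))
          = (∑ η ∈ S, p η * Real.exp (t * g η)) / Real.exp (B * (1 + t ^ 2 / N)) := by
            rw [Finset.sum_div]; exact Finset.sum_congr rfl fun _ _ => by ring
        _ ≤ 1 := by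
            rw [div_le_one (Real.exp_pos _)]; exact hexp t ht)
    have e : ∑ η ∈ S, p η * (f η * (t * g η - B * (1 + t ^ 2 / N))) =
        t * ∑ η ∈ S, p η * (f η * g η) - B * (1 + t ^ 2 / N) * φ := by
      rw [← hfφ, Finset.mul_sum, Finset.mul_sum, ← Finset.sum_sub_distrib]
      exact Finset.sum_congr rfl fun _ _ => by ring
    linarith
  obtain ⟨φ, hφd⟩ : ∃ φ, ∑ η ∈ S, p η * f η = φ := ⟨_, rfl⟩
  have hφ0 : 0 ≤ φ := by
    rw [← hφd]; exact Finset.sum_nonneg fun η hη => mul_nonneg (hp η hη) (hf η)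
  rcases hφ0.eq_or_lt with h0 | hφ
  · have hz : ∀ η ∈ S, p η * f η = 0 :=
      (Finset.sum_eq_zero_iff_of_nonneg (fun η hη => mul_nonneg (hp η hη) (hf η))).1
        (by rw [hφd, h0])
    have : ∑ η ∈ S, p η * (f η * F η) = 0 :=
      Finset.sum_eq_zero fun η hη => by rw [← mul_assoc, hz η hη, zero_mul]
    rw [this, hφd, ← h0]; simp
  rw [hφd]
  obtain ⟨E, hE⟩ : ∃ E, ∑ η ∈ S, p η * (f η * Real.log (f η)) - φ * Real.log φ = E := ⟨_, rfl⟩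
  have hE0 : 0 ≤ E := by
    have := s8_entropy S p f (fun _ => 0) hp hf φ hφ hφd (by simp [hp1])
    simpa [hE] using this
  rw [hE]
  have k1 := key f hf φ hφ hφd
  rw [hE] at k1
  have k2 : ∀ t : ℝ, 0 < t → t * ∑ η ∈ S, p η * g η ≤ B * (1 + t ^ 2 / N) := by
    intro t ht
    have := key (fun _ => 1) (fun _ => zero_le_one) 1 one_pos (by simpa using hp1) t ht
    simpa using this
  have hcov : |∑ η ∈ S, p η * (f η * F η) - φ * (∑ η ∈ S, p η * F η)| ≤
      ∑ η ∈ S, p η * (f η * g η) + φ * ∑ η ∈ S, p η * g η := by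
    have e : ∑ η ∈ S, p η * (f η * F η) - φ * (∑ η ∈ S, p η * F η) =
        ∑ η ∈ S, p η * (f η * (F η - m)) - φ * ∑ η ∈ S, p η * (F η - m) := by
      have e1 : ∑ η ∈ S, p η * (f η * (F η - m)) = ∑ η ∈ S, p η * (f η * F η) - φ * m := by
        rw [← hφd, Finset.sum_mul, ← Finset.sum_sub_distrib]
        exact Finset.sum_congr rfl fun _ _ => by ring
      have e2 : ∑ η ∈ S, p η * (F η - m) = ∑ η ∈ S, p η * F η - m := by
        simp only [mul_sub]
        rw [Finset.sum_sub_distrib, ← Finset.sum_mul, hp1, one_mul]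
      rw [e1, e2]; ring
    rw [e]
    refine (abs_sub _ _).trans (add_le_add ?_ ?_)
    · refine (Finset.abs_sum_le_sum_abs _ _).trans (Finset.sum_le_sum fun η hη => ?_)
      rw [abs_mul, abs_mul, abs_of_nonneg (hp η hη), abs_of_nonneg (hf η)]
      exact mul_le_mul_of_nonneg_left (mul_le_mul_of_nonneg_left (hFg η hη) (hf η)) (hp η hη)
    · rw [abs_mul, abs_of_pos hφ]
      refine mul_le_mul_of_nonneg_left ?_ hφ.le
      refine (Finset.abs_sum_le_sum_abs _ _).trans (Finset.sum_le_sum fun η hη => ?_)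
      rw [abs_mul, abs_of_nonneg (hp η hη)]
      exact mul_le_mul_of_nonneg_left (hFg η hη) (hp η hη)
  set Q := |∑ η ∈ S, p η * (f η * F η) - φ * (∑ η ∈ S, p η * F η)| with hQ
  rw [← sq_abs, ← hQ]
  set t := Real.sqrt (N * (1 + E / φ)) with ht
  have hpos : 0 < N * (1 + E / φ) := by positivity
  have htp : 0 < t := Real.sqrt_pos.2 hpos
  have ht2 : t ^ 2 = N * (1 + E / φ) := Real.sq_sqrt hpos.le
  have ht3 : t ^ 2 / N = 1 + E / φ := by rw [ht2]; field_simp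
  have hE2 : E / φ * φ = E := by field_simp
  have b1 := k1 t htp
  have b2 := mul_le_mul_of_nonneg_left (k2 t htp) hφ.le
  rw [ht3] at b1 b2
  have b3 : t * Q ≤ (4 * B + 1) * (φ + E) := by
    have := mul_le_mul_of_nonneg_left hcov htp.le
    nlinarith [mul_nonneg hB hE0, mul_nonneg hB hφ.le]
  have b4 : (t * Q) ^ 2 ≤ ((4 * B + 1) * (φ + E)) ^ 2 :=
    pow_le_pow_left₀ (mul_nonneg htp.le (abs_nonneg _)) b3 2
  have b5 : t ^ 2 * φ = N * (φ + E) := by rw [ht2]; field_simp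
  have b6 : N * (φ + E) * Q ^ 2 ≤ N * (φ + E) * ((4 * B + 1) ^ 2 * N⁻¹ * φ * (φ + E)) := by
    calc N * (φ + E) * Q ^ 2 = φ * (t * Q) ^ 2 := by rw [← b5]; ring
      _ ≤ φ * ((4 * B + 1) * (φ + E)) ^ 2 := mul_le_mul_of_nonneg_left b4 hφ.le
      _ = _ := by field_simp
  exact le_of_mul_le_mul_left b6 (by positivity)

lemma s8_sinh_le (s : ℝ) (hs : 0 ≤ s) : Real.sinh s ≤ s * Real.cosh s := by
  have h1 : MonotoneOn (fun s : ℝ => s * Real.cosh s - Real.sinh s) (Set.Ici 0) := by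
    apply monotoneOn_of_deriv_nonneg (convex_Ici 0)
    · fun_prop
    · fun_prop
    · intro x hx
      rw [interior_Ici] at hx
      have : HasDerivAt (fun s : ℝ => s * Real.cosh s - Real.sinh s)
          (1 * Real.cosh x + x * Real.sinh x - Real.cosh x) x :=
        ((hasDerivAt_id x).mul (Real.hasDerivAt_cosh x)).sub (Real.hasDerivAt_sinh x)
      rw [this.deriv]
      have := mul_nonneg (le_of_lt hx) (Real.sinh_nonneg_iff.2 (le_of_lt hx))
      linarith
  have := h1 (Set.mem_Ici.2 le_rfl) (Set.mem_Ici.2 hs) hs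
  simp at this
  linarith

/-- Gronwall for `ψ(s) = ∑ p cosh (s X)`. -/
lemma s8_gronwall {Ω : Type*} (S : Finset Ω) (p X : Ω → ℝ) (hp1 : ∑ η ∈ S, p η = 1)
    (a b : ℝ)
    (h : ∀ s : ℝ, 0 < s → ∑ η ∈ S, p η * (X η * Real.sinh (s * X η)) ≤
      (a + b * s) * ∑ η ∈ S, p η * Real.cosh (s * X η)) (s : ℝ) (hs : 0 ≤ s) :
    ∑ η ∈ S, p η * Real.cosh (s * X η) ≤ Real.exp (a * s + b * s ^ 2 / 2) := by
  have hd : ∀ s, HasDerivAt (fun s => (∑ η ∈ S, p η * Real.cosh (s * X η)) *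
      Real.exp (-(a * s + b * s ^ 2 / 2)))
      ((∑ η ∈ S, p η * (X η * Real.sinh (s * X η))) * Real.exp (-(a * s + b * s ^ 2 / 2)) +
        (∑ η ∈ S, p η * Real.cosh (s * X η)) *
        (Real.exp (-(a * s + b * s ^ 2 / 2)) * (-(a + b * s)))) s := by
    intro s
    apply HasDerivAt.mul
    · apply HasDerivAt.fun_sum
      intro η _
      have := (((hasDerivAt_id s).mul_const (X η)).cosh).const_mul (p η)
      have h2 : p η * (X η * Real.sinh (s * X η)) =
          p η * (Real.sinh (id s * X η) * (1 * X η)) := by simp only [id]; ring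
      rw [h2]
      exact this
    · apply HasDerivAt.exp
      have h1 : HasDerivAt (fun s : ℝ => a * s + b * s ^ 2 / 2) (a * 1 + b * (2 * s ) / 2) s := by
        have := ((hasDerivAt_id s).const_mul a).add
          ((((hasDerivAt_id s).pow 2).const_mul b).div_const 2)
        have h2 : a * 1 + b * (2 * s) / 2 = a * 1 + b * (((2 : ℕ) : ℝ) * id s ^ (2 - 1) * 1) / 2 := by
          simp
        rw [h2]
        exact this
      have h3 : -(a + b * s) = -(a * 1 + b * (2 * s) / 2) := by ring
      rw [h3]
      exact h1.neg
  have hanti : AntitoneOn (fun s => (∑ η ∈ S, p η * Real.cosh (s * X η)) *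
      Real.exp (-(a * s + b * s ^ 2 / 2))) (Set.Ici 0) := by
    apply antitoneOn_of_deriv_nonpos (convex_Ici 0)
    · exact fun x _ => (hd x).continuousAt.continuousWithinAt
    · exact fun x _ => (hd x).differentiableAt.differentiableWithinAt
    · intro x hx
      rw [interior_Ici] at hx
      rw [(hd x).deriv]
      have := mul_le_mul_of_nonneg_right (h x hx) (Real.exp_pos (-(a * x + b * x ^ 2 / 2))).le
      linarith
  have := hanti (Set.mem_Ici.2 le_rfl) (Set.mem_Ici.2 hs) hs
  simp only [zero_mul, Real.cosh_zero, mul_one, hp1, mul_zero, ne_eq, OfNat.ofNat_ne_zero,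
    not_false_eq_true, zero_pow, zero_div, add_zero, neg_zero, Real.exp_zero] at this
  rwa [Real.exp_neg, mul_inv_le_iff₀ (Real.exp_pos _), one_mul] at this

lemma s8_c_upper (c : ℕ → ℝ) (a₁ : ℝ) (hLG : ∀ k : ℕ, |c (k + 1) - c k| ≤ a₁) (m k : ℕ) :
    |c (m + k) - c m| ≤ a₁ * k := by
  induction k with
  | zero => simp
  | succ k ih =>
    have := hLG (m + k)
    rw [← add_assoc]
    push_cast
    calc |c (m + k + 1) - c m| = |(c (m + k + 1) - c (m + k)) + (c (m + k) - c m)| := by ring_nf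
      _ ≤ _ := (abs_add_le _ _).trans (by linarith)

lemma s8_c_mono (c : ℕ → ℝ) (a₁ a₂ : ℝ) (k₀ : ℕ)
    (hLG : ∀ k : ℕ, |c (k + 1) - c k| ≤ a₁)
    (hk₀ : 0 < k₀) (ha₂ : 0 < a₂)
    (hM : ∀ j k : ℕ, j + k₀ ≤ k → a₂ ≤ c k - c j) (m k : ℕ) :
    a₂ / k₀ * k - (a₁ * k₀ + a₂) ≤ c (m + k) - c m := by
  have ha1 : 0 ≤ a₁ := (abs_nonneg _).trans (hLG 0)
  have hk : (0 : ℝ) < k₀ := by exact_mod_cast hk₀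
  induction k using Nat.strong_induction_on with
  | _ k ih =>
    by_cases h : k < k₀
    · have h1 := neg_le_of_abs_le (s8_c_upper c a₁ hLG m k)
      have h2 : (k : ℝ) ≤ k₀ := by exact_mod_cast h.le
      have h3 : a₂ / k₀ * k ≤ a₂ / k₀ * k₀ := by gcongr
      have h4 : a₂ / k₀ * k₀ = a₂ := by field_simp
      have h5 : a₁ * k ≤ a₁ * k₀ := by gcongr
      linarith
    · push Not at h
      obtain ⟨j, rfl⟩ := Nat.exists_eq_add_of_le h
      have h1 := ih j (by omega)
      have h2 := hM (m + j) (m + (k₀ + j)) (by omega)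
      have h4 : a₂ / k₀ * k₀ = a₂ := by field_simp
      push_cast
      linarith

lemma s8_c_lower (c : ℕ → ℝ) (a₂ : ℝ) (k₀ : ℕ) (hcpos : ∀ n : ℕ, 0 < n → 0 < c n)
    (hk₀ : 0 < k₀) (ha₂ : 0 < a₂)
    (hM : ∀ j k : ℕ, j + k₀ ≤ k → a₂ ≤ c k - c j) (hc0 : c 0 = 0) :
    ∃ δ > 0, ∀ n : ℕ, δ * n ≤ c n := by
  have hk : (0 : ℝ) < k₀ := by exact_mod_cast hk₀
  have hmin : ∀ M : ℕ, ∃ δ > 0, ∀ n : ℕ, n ≤ M → δ * n ≤ c n := by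
    intro M
    induction M with
    | zero =>
      refine ⟨1, one_pos, ?_⟩
      intro n hn
      obtain rfl : n = 0 := by omega
      simp [hc0]
    | succ M ih =>
      obtain ⟨δ, hδ, h⟩ := ih
      have hc := hcpos (M + 1) (by omega)
      refine ⟨min δ (c (M + 1) / (M + 1 : ℕ)), lt_min hδ (by positivity), ?_⟩
      intro n hn
      rcases Nat.lt_or_ge M n with h1 | h1
      · obtain rfl : n = M + 1 := by omega
        calc _ ≤ c (M + 1) / (M + 1 : ℕ) * (M + 1 : ℕ) := by gcongr; exact min_le_right _ _
          _ = c (M + 1) := by field_simp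
      · refine le_trans ?_ (h n h1)
        gcongr; exact min_le_left _ _
  obtain ⟨δ, hδ, h⟩ := hmin k₀
  refine ⟨min δ (a₂ / k₀), lt_min hδ (by positivity), ?_⟩
  intro n
  induction n using Nat.strong_induction_on with
  | _ n ih =>
    rcases Nat.lt_or_ge n k₀ with h1 | h1
    · refine le_trans ?_ (h n h1.le)
      gcongr; exact min_le_left _ _
    · obtain ⟨j, rfl⟩ := Nat.exists_eq_add_of_le h1
      have h2 := ih j (by omega)
      have h3 := hM j (k₀ + j) (by omega)
      have h4 : min δ (a₂ / k₀) * k₀ ≤ a₂ / k₀ * k₀ := by gcongr; exact min_le_right _ _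
      have h5 : a₂ / k₀ * k₀ = a₂ := by field_simp
      push_cast
      linarith

lemma s8_h_lip (c : ℕ → ℝ) (a₁ δ : ℝ) (hc0 : c 0 = 0) (hδ : 0 < δ) (hlow : ∀ n : ℕ, δ * n ≤ c n)
    (hLG : ∀ k : ℕ, |c (k + 1) - c k| ≤ a₁) (m k : ℕ) :
    |hfun c (m + k) - hfun c m| ≤ 2 * a₁ / δ ^ 2 * k / ((m + k : ℕ) + 1) := by
  have ha1 : 0 ≤ a₁ := (abs_nonneg _).trans (hLG 0)
  have l1 := hlow (m + k + 1)
  have l2 := hlow (m + 1)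
  have u := s8_c_upper c a₁ hLG (m + 1) k
  have u2 := s8_c_upper c a₁ hLG 0 (m + 1)
  rw [hc0, sub_zero, zero_add] at u2
  have u3 := (abs_le.1 u2).2
  rw [show m + 1 + k = m + k + 1 by ring] at u
  push_cast at *
  have p2 : 0 < c (m + 1) := lt_of_lt_of_le (by positivity) l2
  have p1 : 0 < c (m + k + 1) := lt_of_lt_of_le (by positivity) l1
  have e : hfun c (m + k) - hfun c m =
      (k * c (m + 1) - (m + 1) * (c (m + k + 1) - c (m + 1))) / (c (m + k + 1) * c (m + 1)) := by
    unfold hfun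
    push_cast
    field_simp
    ring
  rw [e, abs_div, abs_of_pos (mul_pos p1 p2)]
  have num : |k * c (m + 1) - (m + 1) * (c (m + k + 1) - c (m + 1))| ≤ 2 * a₁ * k * (m + 1) := by
    refine (abs_sub _ _).trans ?_
    rw [abs_mul, abs_mul, abs_of_pos p2, Nat.abs_cast, abs_of_nonneg (by positivity : (0:ℝ) ≤ m + 1)]
    have := mul_le_mul_of_nonneg_left u3 (Nat.cast_nonneg (α := ℝ) k)
    have := mul_le_mul_of_nonneg_left u (by positivity : (0:ℝ) ≤ m + 1)
    linarith
  calc _ ≤ 2 * a₁ * k * (m + 1) / ((δ * (m + k + 1)) * (δ * (m + 1))) := by gcongr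
    _ = _ := by field_simp

lemma s8_h_lip' (c : ℕ → ℝ) (a₁ δ : ℝ) (hc0 : c 0 = 0) (hδ : 0 < δ)
    (hlow : ∀ n : ℕ, δ * n ≤ c n)
    (hLG : ∀ k : ℕ, |c (k + 1) - c k| ≤ a₁) (n q : ℕ) :
    |hfun c n - hfun c q| ≤ 2 * a₁ / δ ^ 2 * |(n : ℝ) - q| / (q + 1) := by
  have ha1 : 0 ≤ a₁ := (abs_nonneg _).trans (hLG 0)
  rcases le_total q n with h | h
  · obtain ⟨k, rfl⟩ := Nat.exists_eq_add_of_le h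
    refine (s8_h_lip c a₁ δ hc0 hδ hlow hLG q k).trans ?_
    push_cast
    rw [add_sub_cancel_left, Nat.abs_cast]
    gcongr
    linarith [Nat.cast_nonneg (α := ℝ) k]
  · obtain ⟨k, rfl⟩ := Nat.exists_eq_add_of_le h
    rw [abs_sub_comm]
    refine (s8_h_lip c a₁ δ hc0 hδ hlow hLG n k).trans ?_
    push_cast
    rw [abs_sub_comm, add_sub_cancel_left, Nat.abs_cast]

lemma s8_drift (c : ℕ → ℝ) (κ K : ℝ) (hc : ∀ m k : ℕ, κ * k - K ≤ c (m + k) - c m)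
    (hK : 0 ≤ K) (s : ℝ) (hs : 0 ≤ s) (n m : ℕ) :
    κ * (((n : ℝ) - m) * Real.sinh (s * ((n : ℝ) - m))) - K * Real.cosh (s * ((n : ℝ) - m)) ≤
      (c n - c m) * Real.sinh (s * ((n : ℝ) - m)) := by
  have main : ∀ m k : ℕ, κ * ((k : ℝ) * Real.sinh (s * k)) - K * Real.cosh (s * k) ≤
      (c (m + k) - c m) * Real.sinh (s * k) := by
    intro m k
    have h1 : 0 ≤ Real.sinh (s * k) := Real.sinh_nonneg_iff.2 (by positivity)
    have h2 := mul_le_mul_of_nonneg_right (hc m k) h1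
    have h3 := mul_le_mul_of_nonneg_left (Real.sinh_lt_cosh (s * k)).le hK
    linarith
  rcases le_total m n with h | h
  · obtain ⟨k, rfl⟩ := Nat.exists_eq_add_of_le h
    have := main m k
    push_cast
    rwa [add_sub_cancel_left]
  · obtain ⟨k, rfl⟩ := Nat.exists_eq_add_of_le h
    have := main n k
    push_cast
    rw [show (n : ℝ) - (n + k) = -k by ring, mul_neg, Real.sinh_neg, Real.cosh_neg]
    linarith

lemma s8_cfact_pos (c : ℕ → ℝ) (hcpos : ∀ n : ℕ, 0 < n → 0 < c n) (n : ℕ) : 0 < cfact c n := by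
  induction n with
  | zero => simp [cfact]
  | succ n ih => exact mul_pos ih (hcpos _ (by omega))

/-- The reflected jump. -/
def s8inv (x y : ℤ) (η : ℤ → ℕ) : ℤ → ℕ :=
  fun z => if z = x then η y + 1 else if z = y then η x - 1 else η z

lemma s8_split {M : Type*} [CommMonoid M] (Λ : Finset ℤ) (x y : ℤ) (hx : x ∈ Λ) (hy : y ∈ Λ)
    (hxy : x ≠ y) (g : ℤ → M) :
    ∏ z ∈ Λ, g z = g x * (g y * ∏ z ∈ (Λ.erase x).erase y, g z) := by
  rw [Finset.mul_prod_erase _ _ (Finset.mem_erase.2 ⟨hxy.symm, hy⟩), Finset.mul_prod_erase _ _ hx]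

lemma s8_split_add (Λ : Finset ℤ) (x y : ℤ) (hx : x ∈ Λ) (hy : y ∈ Λ)
    (hxy : x ≠ y) (g : ℤ → ℕ) :
    ∑ z ∈ Λ, g z = g x + (g y + ∑ z ∈ (Λ.erase x).erase y, g z) := by
  rw [Finset.add_sum_erase _ _ (Finset.mem_erase.2 ⟨hxy.symm, hy⟩), Finset.add_sum_erase _ _ hx]

lemma s8_exchange (c : ℕ → ℝ) (hc0 : c 0 = 0) (hcpos : ∀ n : ℕ, 0 < n → 0 < c n)
    (Λ : Finset ℤ) (N : ℕ) (x y : ℤ) (hx : x ∈ Λ) (hy : y ∈ Λ) (hxy : x ≠ y) (s : ℝ) :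
    ∑ η ∈ Finset.piAntidiag Λ N, (∏ z ∈ Λ, (cfact c (η z))⁻¹) *
      (c (η x) * Real.sinh (s * ((η x : ℝ) - η y - 1))) = 0 := by
  classical
  have hfilt : ∑ η ∈ (Finset.piAntidiag Λ N).filter (fun η => 1 ≤ η x),
      (∏ z ∈ Λ, (cfact c (η z))⁻¹) * (c (η x) * Real.sinh (s * ((η x : ℝ) - η y - 1))) =
      ∑ η ∈ Finset.piAntidiag Λ N, (∏ z ∈ Λ, (cfact c (η z))⁻¹) *
      (c (η x) * Real.sinh (s * ((η x : ℝ) - η y - 1))) := by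
    apply Finset.sum_filter_of_ne
    intro η _ hne
    by_contra h
    apply hne
    have : η x = 0 := by omega
    simp [this, hc0]
  rw [← hfilt]
  have vx : ∀ η, s8inv x y η x = η y + 1 := fun η => by simp [s8inv]
  have vy : ∀ η, s8inv x y η y = η x - 1 := fun η => by simp [s8inv, hxy.symm]
  have vz : ∀ η, ∀ z ∈ (Λ.erase x).erase y, s8inv x y η z = η z := fun η z hz => by
    simp only [Finset.mem_erase] at hz
    simp [s8inv, hz.1, hz.2.1]
  have hsum : ∀ η ∈ (Finset.piAntidiag Λ N).filter (fun η => 1 ≤ η x),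
      (∏ z ∈ Λ, (cfact c (η z))⁻¹) * (c (η x) * Real.sinh (s * ((η x : ℝ) - η y - 1))) +
      (∏ z ∈ Λ, (cfact c (s8inv x y η z))⁻¹) * (c (s8inv x y η x) *
        Real.sinh (s * ((s8inv x y η x : ℝ) - s8inv x y η y - 1))) = 0 := by
    intro η hη
    have h1 := (Finset.mem_filter.1 hη).2
    have hpr : ∏ z ∈ (Λ.erase x).erase y, (cfact c (s8inv x y η z))⁻¹ =
        ∏ z ∈ (Λ.erase x).erase y, (cfact c (η z))⁻¹ :=
      Finset.prod_congr rfl (fun z hz => by rw [vz η z hz])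
    rw [s8_split Λ x y hx hy hxy, s8_split Λ x y hx hy hxy, vx, vy, hpr]
    obtain ⟨k, hk⟩ := Nat.exists_eq_add_of_le' h1
    rw [hk]
    have e1 : s * (((η y + 1 : ℕ) : ℝ) - ((k + 1 - 1 : ℕ) : ℝ) - 1) =
        -(s * (((k + 1 : ℕ) : ℝ) - (η y : ℝ) - 1)) := by
      simp only [Nat.add_sub_cancel]; push_cast; ring
    rw [e1, Real.sinh_neg]
    simp only [Nat.add_sub_cancel, cfact]
    have p1 := (s8_cfact_pos c hcpos k).ne'
    have p2 := (s8_cfact_pos c hcpos (η y)).ne'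
    have p3 := (hcpos (k + 1) (by omega)).ne'
    have p4 := (hcpos (η y + 1) (by omega)).ne'
    field_simp
    ring
  refine Finset.sum_involution (fun η _ => s8inv x y η) hsum ?_ ?_ ?_
  · intro η hη hne heq
    have := hsum η hη
    rw [heq] at this
    exact hne (by linarith)
  · intro η hη
    rw [Finset.mem_filter, Finset.mem_piAntidiag] at hη ⊢
    obtain ⟨⟨h1, h2⟩, h3⟩ := hη
    refine ⟨⟨?_, ?_⟩, ?_⟩
    · rw [s8_split_add Λ x y hx hy hxy] at h1 ⊢
      have hsr : ∑ z ∈ (Λ.erase x).erase y, s8inv x y η z =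
          ∑ z ∈ (Λ.erase x).erase y, η z := Finset.sum_congr rfl (vz η)
      rw [vx, vy, hsr]
      omega
    · intro z hz
      by_cases hzx : z = x
      · rwa [hzx]
      by_cases hzy : z = y
      · rwa [hzy]
      apply h2
      simpa [s8inv, hzx, hzy] using hz
    · rw [vx]; omega
  · intro η hη
    have h1 := (Finset.mem_filter.1 hη).2
    funext z
    by_cases hzx : z = x
    · rw [hzx, vx, vy]; omega
    by_cases hzy : z = y
    · rw [hzy, vy, vx]; omega
    simp [s8inv, hzx, hzy]

lemma s8_subG (c : ℕ → ℝ) (a₁ κ K : ℝ) (hc0 : c 0 = 0) (hcpos : ∀ n : ℕ, 0 < n → 0 < c n)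
    (hup : ∀ n : ℕ, c n ≤ a₁ * n) (ha₁ : 0 ≤ a₁) (hκ : 0 < κ) (hK : 0 ≤ K)
    (hc : ∀ m k : ℕ, κ * k - K ≤ c (m + k) - c m)
    (Λ : Finset ℤ) (N : ℕ) (Z : ℝ) (hZ : 0 < Z)
    (hp1 : ∑ η ∈ Finset.piAntidiag Λ N, (∏ z ∈ Λ, (cfact c (η z))⁻¹) / Z = 1)
    (x y : ℤ) (hx : x ∈ Λ) (hy : y ∈ Λ) (s : ℝ) (hs : 0 ≤ s) :
    ∑ η ∈ Finset.piAntidiag Λ N, (∏ z ∈ Λ, (cfact c (η z))⁻¹) / Z *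
      Real.cosh (s * ((η x : ℝ) - η y)) ≤ Real.exp (K / κ * s + 2 * a₁ * N / κ * s ^ 2 / 2) := by
  by_cases hxy : x = y
  · subst hxy
    simp only [sub_self, mul_zero, Real.cosh_zero, mul_one, hp1]
    rw [Real.one_le_exp_iff]
    positivity
  refine s8_gronwall _ _ (fun η : ℤ → ℕ => (η x : ℝ) - η y) hp1 _ _ ?_ s hs
  clear hs s
  intro s hs
  set p : (ℤ → ℕ) → ℝ := fun η => (∏ z ∈ Λ, (cfact c (η z))⁻¹) / Z with hp
  have hp0 : ∀ η, 0 ≤ p η := fun η =>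
    div_nonneg (Finset.prod_nonneg fun z _ => (inv_pos.2 (s8_cfact_pos c hcpos _)).le) hZ.le
  have ex : ∀ x y : ℤ, x ∈ Λ → y ∈ Λ → x ≠ y → ∑ η ∈ Finset.piAntidiag Λ N, p η *
      (c (η x) * Real.sinh (s * ((η x : ℝ) - η y - 1))) = 0 := by
    intro x y hx hy hxy
    have := s8_exchange c hc0 hcpos Λ N x y hx hy hxy s
    have e : ∀ η : ℤ → ℕ, p η * (c (η x) * Real.sinh (s * ((η x : ℝ) - η y - 1))) =
        ((∏ z ∈ Λ, (cfact c (η z))⁻¹) * (c (η x) * Real.sinh (s * ((η x : ℝ) - η y - 1)))) / Z := by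
      intro η; simp only [hp]; ring
    simp only [e]
    rw [← Finset.sum_div, this, zero_div]
  have e1 := ex x y hx hy hxy
  have e2 := ex y x hy hx (Ne.symm hxy)
  change ∑ η ∈ Finset.piAntidiag Λ N, p η * (((η x : ℝ) - η y) * Real.sinh (s * ((η x : ℝ) - η y)))
    ≤ _ * ∑ η ∈ Finset.piAntidiag Λ N, p η * Real.cosh (s * ((η x : ℝ) - η y))
  have hid : Real.cosh s * ∑ η ∈ Finset.piAntidiag Λ N, p η *
        ((c (η x) - c (η y)) * Real.sinh (s * ((η x : ℝ) - η y))) =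
      Real.sinh s * ∑ η ∈ Finset.piAntidiag Λ N, p η *
        ((c (η x) + c (η y)) * Real.cosh (s * ((η x : ℝ) - η y))) := by
    rw [← sub_eq_zero, Finset.mul_sum, Finset.mul_sum, ← Finset.sum_sub_distrib]
    rw [← add_zero (0 : ℝ)]
    nth_rewrite 1 [← e1]
    rw [← e2, ← Finset.sum_add_distrib]
    apply Finset.sum_congr rfl
    intro η _
    rw [show s * ((η x : ℝ) - η y - 1) = s * ((η x : ℝ) - η y) - s by ring,
      show s * ((η y : ℝ) - η x - 1) = -(s * ((η x : ℝ) - η y) + s) by ring,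
      Real.sinh_neg, Real.sinh_add, Real.sinh_sub]
    ring
  set ψ := ∑ η ∈ Finset.piAntidiag Λ N, p η * Real.cosh (s * ((η x : ℝ) - η y)) with hψ
  set D := ∑ η ∈ Finset.piAntidiag Λ N, p η *
        ((c (η x) - c (η y)) * Real.sinh (s * ((η x : ℝ) - η y))) with hD
  have hψ0 : 0 ≤ ψ := Finset.sum_nonneg fun η _ => mul_nonneg (hp0 η) (Real.cosh_pos _).le
  have low : κ * ∑ η ∈ Finset.piAntidiag Λ N, p η *
      (((η x : ℝ) - η y) * Real.sinh (s * ((η x : ℝ) - η y))) - K * ψ ≤ D := by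
    rw [hψ, hD, Finset.mul_sum, Finset.mul_sum, ← Finset.sum_sub_distrib]
    apply Finset.sum_le_sum
    intro η _
    have := mul_le_mul_of_nonneg_left (s8_drift c κ K hc hK s hs.le (η x) (η y)) (hp0 η)
    linarith
  have up : ∑ η ∈ Finset.piAntidiag Λ N, p η *
        ((c (η x) + c (η y)) * Real.cosh (s * ((η x : ℝ) - η y))) ≤ 2 * a₁ * N * ψ := by
    rw [hψ, Finset.mul_sum]
    apply Finset.sum_le_sum
    intro η hη
    have hle : ∀ z ∈ Λ, c (η z) ≤ a₁ * N := by
      intro z hz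
      refine (hup _).trans (mul_le_mul_of_nonneg_left ?_ ha₁)
      have h1 := (Finset.mem_piAntidiag.1 hη).1
      have h2 := Finset.single_le_sum (f := η) (fun i _ => Nat.zero_le _) hz
      exact_mod_cast h2.trans h1.le
    have h3 : c (η x) + c (η y) ≤ 2 * a₁ * N := by linarith [hle x hx, hle y hy]
    have h4 := mul_le_mul_of_nonneg_right h3
      (mul_nonneg (hp0 η) (Real.cosh_pos (s * ((η x : ℝ) - η y))).le)
    linarith
  have D1 : Real.cosh s * D ≤ Real.cosh s * (s * (2 * a₁ * N * ψ)) := by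
    rw [hid]
    calc _ ≤ Real.sinh s * (2 * a₁ * N * ψ) :=
          mul_le_mul_of_nonneg_left up (Real.sinh_nonneg_iff.2 hs.le)
      _ ≤ (s * Real.cosh s) * (2 * a₁ * N * ψ) :=
          mul_le_mul_of_nonneg_right (s8_sinh_le s hs.le) (by positivity)
      _ = _ := by ring
  have D2 := le_of_mul_le_mul_left D1 (Real.cosh_pos s)
  refine le_of_mul_le_mul_left ?_ hκ
  calc _ ≤ K * ψ + s * (2 * a₁ * N * ψ) := by linarith
    _ = _ := by field_simp

lemma s8_wE (c : ℕ → ℝ) (Λ : Finset ℤ) (N : ℕ) (f : (ℤ → ℕ) → ℝ) :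
    wE (nuW c Λ N) f = ∑ η ∈ Finset.piAntidiag Λ N, (∏ z ∈ Λ, (cfact c (η z))⁻¹) /
      (∑ η ∈ Finset.piAntidiag Λ N, ∏ z ∈ Λ, (cfact c (η z))⁻¹) * f η := by
  have hmem : ∀ η : ℤ → ℕ, η ∈ Finset.piAntidiag Λ N ↔
      η ∈ {η : ℤ → ℕ | (∀ x, x ∉ Λ → η x = 0) ∧ (∑ x ∈ Λ, η x) = N} := by
    intro η
    rw [Finset.mem_piAntidiag, Set.mem_ofPred_eq, and_comm]
    refine and_congr ?_ Iff.rfl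
    exact forall_congr' fun x => by rw [not_imp_comm]
  have hin : ∀ η ∈ Finset.piAntidiag Λ N, nuW c Λ N η = ∏ z ∈ Λ, (cfact c (η z))⁻¹ :=
    fun η hη => Set.indicator_of_mem ((hmem η).1 hη) _
  have hout : ∀ η ∉ Finset.piAntidiag Λ N, nuW c Λ N η = 0 :=
    fun η hη => Set.indicator_of_notMem (fun h => hη ((hmem η).2 h)) _
  unfold wE
  rw [tsum_eq_sum (s := Finset.piAntidiag Λ N) (fun η hη => by rw [hout η hη, zero_mul]),
    tsum_eq_sum (s := Finset.piAntidiag Λ N) (fun η hη => hout η hη),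
    Finset.sum_congr rfl hin, Finset.sum_div]
  apply Finset.sum_congr rfl
  intro η hη
  rw [hin η hη]
  ring

lemma s8_jensen {ι : Type*} (I : Finset ι) (n : ℝ) (hn : (I.card : ℝ) = n) (hn0 : 0 < n)
    (X : ι → ℝ) :
    Real.exp (∑ i ∈ I, X i) ≤ n⁻¹ * ∑ i ∈ I, Real.exp (n * X i) := by
  have := convexOn_exp.map_sum_le (t := I) (w := fun _ => n⁻¹) (p := fun i => n * X i)
    (fun _ _ => by positivity) (by rw [Finset.sum_const, nsmul_eq_mul, hn]; field_simp)
    (fun _ _ => Set.mem_univ _)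
  simp only [smul_eq_mul] at this
  rw [Finset.mul_sum]
  have e : ∀ i, n⁻¹ * (n * X i) = X i := fun i => by field_simp
  simpa only [e] using this

/-- Proposition 3.6, inequality (3.24). -/
theorem statement8
    (c : ℕ → ℝ) (a₁ a₂ : ℝ) (k₀ : ℕ)
    (hc0 : c 0 = 0) (hcpos : ∀ n : ℕ, 0 < n → 0 < c n)
    (hLG : ∀ k : ℕ, |c (k + 1) - c k| ≤ a₁)
    (hk₀ : 0 < k₀) (ha₂ : 0 < a₂)
    (hM : ∀ j k : ℕ, j + k₀ ≤ k → a₂ ≤ c k - c j)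
    (L : ℕ) (hL : 1 ≤ L) :
    ∃ C : ℝ, 0 < C ∧ ∀ (a : ℤ) (N : ℕ), 1 ≤ N →
      ∀ f : (ℤ → ℕ) → ℝ, (∀ η, 0 ≤ f η) →
        (wCov (nuW c (Finset.Ico a (a + (L : ℤ))) N) f
            (fun η => ∑ x ∈ Finset.Ico a (a + (L : ℤ)), hfun c (η x))) ^ 2
          ≤ C * (N : ℝ)⁻¹ * wE (nuW c (Finset.Ico a (a + (L : ℤ))) N) f *
              (wE (nuW c (Finset.Ico a (a + (L : ℤ))) N) f +
                wEnt (nuW c (Finset.Ico a (a + (L : ℤ))) N) f) := by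
  obtain ⟨δ, hδ, hlow⟩ := s8_c_lower c a₂ k₀ hcpos hk₀ ha₂ hM hc0
  have ha1 : 0 ≤ a₁ := (abs_nonneg _).trans (hLG 0)
  have hk : (0 : ℝ) < k₀ := by exact_mod_cast hk₀
  have hLpos : (0 : ℝ) < L := by exact_mod_cast hL
  obtain ⟨κ, hκd⟩ : ∃ κ : ℝ, κ = a₂ / k₀ := ⟨_, rfl⟩
  obtain ⟨K, hKd⟩ : ∃ K : ℝ, K = a₁ * k₀ + a₂ := ⟨_, rfl⟩
  have hκ : 0 < κ := by rw [hκd]; positivity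
  have hK : 0 ≤ K := by rw [hKd]; positivity
  have hdrift : ∀ m k : ℕ, κ * k - K ≤ c (m + k) - c m := by
    intro m k
    rw [hκd, hKd]
    exact s8_c_mono c a₁ a₂ k₀ hLG hk₀ ha₂ hM m k
  have hup : ∀ n : ℕ, c n ≤ a₁ * n := by
    intro n
    have := (abs_le.1 (s8_c_upper c a₁ hLG 0 n)).2
    rwa [hc0, sub_zero, zero_add] at this
  obtain ⟨A, hAd⟩ : ∃ A : ℝ, A = 2 * a₁ / δ ^ 2 := ⟨_, rfl⟩
  have hA : 0 ≤ A := by rw [hAd]; positivity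
  have hlip : ∀ n q : ℕ, |hfun c n - hfun c q| ≤ A * |(n : ℝ) - q| / (q + 1) := by
    intro n q
    rw [hAd]
    exact s8_h_lip' c a₁ δ hc0 hδ hlow hLG n q
  obtain ⟨n, hnd⟩ : ∃ n : ℝ, n = (L : ℝ) * L := ⟨_, rfl⟩
  have hn0 : 0 < n := by rw [hnd]; positivity
  obtain ⟨R, hRd⟩ : ∃ R : ℝ, R = n ^ 2 * A ^ 2 := ⟨_, rfl⟩
  have hR : 0 ≤ R := by rw [hRd]; positivity
  obtain ⟨B, hBd⟩ : ∃ B : ℝ, B = 2 + K / κ + (1 + K / κ + a₁ / κ) * R := ⟨_, rfl⟩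
  have hB : 0 ≤ B := by rw [hBd]; positivity
  refine ⟨(4 * B + 1) ^ 2, by positivity, ?_⟩
  intro a N hN f hf
  have hN1 : (1 : ℝ) ≤ N := by exact_mod_cast hN
  have hN0 : (0 : ℝ) < N := by linarith
  have hcard : ((Finset.Ico a (a + (L : ℤ))).card : ℝ) = L := by simp
  have haΛ : a ∈ Finset.Ico a (a + (L : ℤ)) := by
    rw [Finset.mem_Ico]; omega
  generalize hΛ : Finset.Ico a (a + (L : ℤ)) = Λ at hcard haΛ ⊢
  simp only [wCov, wEnt, s8_wE]
  obtain ⟨Z, hZd⟩ : ∃ Z : ℝ, Z = ∑ η ∈ Finset.piAntidiag Λ N, ∏ z ∈ Λ, (cfact c (η z))⁻¹ :=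
    ⟨_, rfl⟩
  rw [← hZd]
  have hW : ∀ η : ℤ → ℕ, 0 < ∏ z ∈ Λ, (cfact c (η z))⁻¹ :=
    fun η => Finset.prod_pos fun z _ => inv_pos.2 (s8_cfact_pos c hcpos _)
  have hZ : 0 < Z := by
    rw [hZd]
    apply Finset.sum_pos (fun η _ => hW η)
    refine ⟨Pi.single a N, ?_⟩
    rw [Finset.mem_piAntidiag]
    refine ⟨?_, ?_⟩
    · simp [Finset.sum_pi_single', haΛ]
    · intro i hi
      by_cases h : i = a
      · rwa [h]
      · simp [h] at hi
  have hp1 : ∑ η ∈ Finset.piAntidiag Λ N, (∏ z ∈ Λ, (cfact c (η z))⁻¹) / Z = 1 := by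
    rw [← Finset.sum_div, ← hZd]; exact div_self hZ.ne'
  have hp0 : ∀ η ∈ Finset.piAntidiag Λ N, 0 ≤ (∏ z ∈ Λ, (cfact c (η z))⁻¹) / Z :=
    fun η _ => (div_pos (hW η) hZ).le
  refine s8_final (Finset.piAntidiag Λ N) (fun η => (∏ z ∈ Λ, (cfact c (η z))⁻¹) / Z) f
    (fun η => ∑ x ∈ Λ, hfun c (η x))
    (fun η => ∑ i ∈ Λ ×ˢ Λ, A / N * (|(η i.1 : ℝ) - η i.2| + 1))
    (∑ x ∈ Λ, hfun c (N / L)) B N hp0 hp1 hf hB hN0 ?_ ?_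
  · intro η hη
    have hsum : ∑ y ∈ Λ, (η y : ℝ) = N := by
      exact_mod_cast (Finset.mem_piAntidiag.1 hη).1
    rw [← Finset.sum_sub_distrib, Finset.sum_product]
    refine (Finset.abs_sum_le_sum_abs _ _).trans (Finset.sum_le_sum fun x _ => ?_)
    refine (hlip _ _).trans ?_
    dsimp only
    rw [← Finset.mul_sum, Finset.sum_add_distrib, Finset.sum_const, nsmul_eq_mul, mul_one, hcard]
    obtain ⟨q, hq⟩ : ∃ q, N / L = q := ⟨_, rfl⟩
    have hq1 : L * q ≤ N := by rw [← hq]; exact Nat.mul_div_le N L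
    have hq2 : N ≤ L * q + L := by
      rw [← hq]
      have h1 := Nat.div_add_mod N L
      have h2 := Nat.mod_lt N (by omega : L > 0)
      omega
    have hq1' : (L : ℝ) * q ≤ N := by exact_mod_cast hq1
    have hq2' : (N : ℝ) ≤ L * q + L := by exact_mod_cast hq2
    rw [hq]
    have hd : L * |(η x : ℝ) - q| ≤ ∑ y ∈ Λ, |(η x : ℝ) - η y| + L := by
      have e : (L : ℝ) * ((η x : ℝ) - q) = ∑ y ∈ Λ, ((η x : ℝ) - η y) + (N - L * q) := by
        rw [Finset.sum_sub_distrib, Finset.sum_const, nsmul_eq_mul, hcard, hsum]; ring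
      rw [← abs_of_pos hLpos, ← abs_mul, abs_of_pos hLpos, e]
      refine (abs_add_le _ _).trans (add_le_add (Finset.abs_sum_le_sum_abs _ _) ?_)
      rw [abs_of_nonneg (by linarith)]
      linarith
    calc A * |(η x : ℝ) - q| / (q + 1) = A * (L * |(η x : ℝ) - q|) / (L * q + L) := by
          field_simp
      _ ≤ A * (∑ y ∈ Λ, |(η x : ℝ) - η y| + L) / N := by gcongr
      _ = _ := by ring
  · intro t ht
    obtain ⟨s, hsd⟩ : ∃ s : ℝ, s = n * t * A / N := ⟨_, rfl⟩
    have hs : 0 ≤ s := by rw [hsd]; positivity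
    have hcard2 : ((Λ ×ˢ Λ).card : ℝ) = n := by
      rw [Finset.card_product, Nat.cast_mul, hcard, hnd]
    have hpt : ∀ η : ℤ → ℕ,
        Real.exp (t * ∑ i ∈ Λ ×ˢ Λ, A / N * (|(η i.1 : ℝ) - η i.2| + 1)) ≤
        n⁻¹ * ∑ i ∈ Λ ×ˢ Λ, Real.exp s * (2 * Real.cosh (s * ((η i.1 : ℝ) - η i.2))) := by
      intro η
      rw [Finset.mul_sum]
      refine (s8_jensen (Λ ×ˢ Λ) n hcard2 hn0 _).trans ?_
      refine mul_le_mul_of_nonneg_left (Finset.sum_le_sum fun i _ => ?_) (by positivity)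
      have e : n * (t * (A / N * (|(η i.1 : ℝ) - η i.2| + 1))) =
          s + |s * ((η i.1 : ℝ) - η i.2)| := by
        rw [abs_mul, abs_of_nonneg hs, hsd]; ring
      rw [e, Real.exp_add]
      refine mul_le_mul_of_nonneg_left ?_ (Real.exp_pos _).le
      rw [← Real.cosh_abs (s * ((η i.1 : ℝ) - η i.2)), Real.cosh_eq]
      have := Real.exp_pos (-|s * ((η i.1 : ℝ) - η i.2)|)
      linarith
    have hsub : ∀ i ∈ Λ ×ˢ Λ, ∑ η ∈ Finset.piAntidiag Λ N, (∏ z ∈ Λ, (cfact c (η z))⁻¹) / Z *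
        Real.cosh (s * ((η i.1 : ℝ) - η i.2)) ≤
        Real.exp (K / κ * s + 2 * a₁ * N / κ * s ^ 2 / 2) := by
      intro i hi
      rw [Finset.mem_product] at hi
      exact s8_subG c a₁ κ K hc0 hcpos hup ha1 hκ hK hdrift Λ N Z hZ hp1 i.1 i.2 hi.1 hi.2 s hs
    calc _ ≤ ∑ η ∈ Finset.piAntidiag Λ N, (∏ z ∈ Λ, (cfact c (η z))⁻¹) / Z *
          (n⁻¹ * ∑ i ∈ Λ ×ˢ Λ, Real.exp s * (2 * Real.cosh (s * ((η i.1 : ℝ) - η i.2)))) :=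
          Finset.sum_le_sum fun η hη => mul_le_mul_of_nonneg_left (hpt η) (hp0 η hη)
      _ = n⁻¹ * (2 * Real.exp s) * ∑ i ∈ Λ ×ˢ Λ, ∑ η ∈ Finset.piAntidiag Λ N,
          (∏ z ∈ Λ, (cfact c (η z))⁻¹) / Z * Real.cosh (s * ((η i.1 : ℝ) - η i.2)) := by
          rw [Finset.sum_comm, Finset.mul_sum]
          apply Finset.sum_congr rfl
          intro η _
          simp only [Finset.mul_sum]
          apply Finset.sum_congr rfl
          intro i _
          ring
      _ ≤ n⁻¹ * (2 * Real.exp s) * ∑ i ∈ Λ ×ˢ Λ,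
          Real.exp (K / κ * s + 2 * a₁ * N / κ * s ^ 2 / 2) :=
          mul_le_mul_of_nonneg_left (Finset.sum_le_sum hsub) (by positivity)
      _ = 2 * (Real.exp s * Real.exp (K / κ * s + 2 * a₁ * N / κ * s ^ 2 / 2)) := by
          rw [Finset.sum_const, nsmul_eq_mul, hcard2]
          field_simp
      _ ≤ Real.exp 1 * (Real.exp s * Real.exp (K / κ * s + 2 * a₁ * N / κ * s ^ 2 / 2)) := by
          have := Real.add_one_le_exp (1 : ℝ)
          gcongr
          linarith
      _ = Real.exp (1 + (s + (K / κ * s + 2 * a₁ * N / κ * s ^ 2 / 2))) := by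
          simp only [Real.exp_add]
      _ ≤ _ := by
          rw [Real.exp_le_exp]
          have h1 : N * s ^ 2 = R * (t ^ 2 / N) := by
            rw [hsd, hRd]; field_simp
          have h2 : s ≤ 1 + R * (t ^ 2 / N) := by
            rw [← h1]; nlinarith [sq_nonneg (s - 1), sq_nonneg s]
          have h3 : 2 * a₁ * N / κ * s ^ 2 / 2 = a₁ / κ * (R * (t ^ 2 / N)) := by
            rw [← h1]; ring
          rw [h3, hBd]
          have hK' : 0 ≤ K / κ := by positivity
          have ha' : 0 ≤ a₁ / κ := by positivity
          have hu : 0 ≤ t ^ 2 / N := by positivity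
          have h4 := mul_le_mul_of_nonneg_left h2 hK'
          have h5 : 0 ≤ (1 + K / κ + a₁ / κ) * R := by positivity
          have h6 : 0 ≤ (2 + K / κ) * (t ^ 2 / N) := by positivity
          nlinarith
end
end
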